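/- Let n ≥ 2, let Ω be a domain (nonempty open connected set) in ℂⁿ, and let Φ : [0,1] × Ω → ℂⁿ be continuous, such that for each t ∈ [0,1] the map Φ_t = Φ(t,·) : Ω → ℂⁿ is injective and holomorphic, Φ₀ is the identity map on Ω, and the open set Ω_t = Φ_t(Ω) is Runge in ℂⁿ for every t ∈ [0,1]. Then Φ₁ can be approximated uniformly on compact subsets of Ω by finite compositions of shears: for every compact K ⊆ Ω and ε > 0 there is a finite composition ψ of shears of ℂⁿ with ‖ψ(z) − Φ₁(z)‖ < ε for all z ∈ K. -/

import Mathlib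

noncomputable section

/-- A "basic shear" of ℂⁿ. -/
def IsBasicShear {n : ℕ} (Φ : EuclideanSpace ℂ (Fin n) → EuclideanSpace ℂ (Fin n)) : Prop :=
  ∃ (i : Fin n) (f g : EuclideanSpace ℂ (Fin n) → ℂ),
    (i : ℕ) = n - 1 ∧
    Differentiable ℂ f ∧ Differentiable ℂ g ∧
    (∀ z w : EuclideanSpace ℂ (Fin n), (∀ j : Fin n, j ≠ i → z j = w j) → f z = f w) ∧
    (∀ z w : EuclideanSpace ℂ (Fin n), (∀ j : Fin n, j ≠ i → z j = w j) → g z = g w) ∧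
    (∀ z : EuclideanSpace ℂ (Fin n), Φ z i = Complex.exp (f z) * z i + g z) ∧
    (∀ z : EuclideanSpace ℂ (Fin n), ∀ j : Fin n, j ≠ i → Φ z j = z j)

/-- A shear of ℂⁿ: a `GLₙ(ℂ)`-conjugate `A⁻¹ ∘ Φ ∘ A` of a basic shear `Φ`. -/
def IsShear {n : ℕ} (ψ : EuclideanSpace ℂ (Fin n) → EuclideanSpace ℂ (Fin n)) : Prop :=
  ∃ (A : EuclideanSpace ℂ (Fin n) ≃L[ℂ] EuclideanSpace ℂ (Fin n))
    (Φ : EuclideanSpace ℂ (Fin n) → EuclideanSpace ℂ (Fin n)),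
    IsBasicShear Φ ∧ ψ = fun z => A.symm (Φ (A z))

/-- A finite composition of shears of ℂⁿ. -/
def IsShearComposition {n : ℕ} (ψ : EuclideanSpace ℂ (Fin n) → EuclideanSpace ℂ (Fin n)) : Prop :=
  ∃ L : List (EuclideanSpace ℂ (Fin n) → EuclideanSpace ℂ (Fin n)),
    L ≠ [] ∧ (∀ φ ∈ L, IsShear φ) ∧ ψ = L.foldr (· ∘ ·) id

/-- An open set Ω ⊆ ℂⁿ is Runge if every function holomorphic on Ω can be approximated
uniformly on compact subsets of Ω by polynomials. -/
def IsRunge {n : ℕ} (Ω : Set (EuclideanSpace ℂ (Fin n))) : Prop :=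
  ∀ g : EuclideanSpace ℂ (Fin n) → ℂ, DifferentiableOn ℂ g Ω →
    ∀ K : Set (EuclideanSpace ℂ (Fin n)), K ⊆ Ω → IsCompact K → ∀ ε : ℝ, 0 < ε →
      ∃ p : MvPolynomial (Fin n) ℂ,
        ∀ z ∈ K, ‖g z - MvPolynomial.eval (fun i => z i) p‖ < ε

section

open Set Metric Filter Topology

section Holomorphic

variable {E F : Type*} [NormedAddCommGroup E] [NormedSpace ℂ E] [NormedAddCommGroup F]
  [NormedSpace ℂ F]

/-- Cauchy estimate in Lipschitz form. -/
theorem norm_sub_le_of_norm_le_on_ball {f : E → F} {y : E} {r M : ℝ} (hr : 0 < r)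
    (hf : DifferentiableOn ℂ f (ball y r)) (hM : ∀ z ∈ ball y r, ‖f z‖ ≤ M)
    {a b : E} (ha : a ∈ ball y (r / 4)) (hb : b ∈ ball y (r / 4)) :
    ‖f a - f b‖ ≤ 4 * M / r * ‖a - b‖ := by
  have hsub : ball b (r / 2) ⊆ ball y r := by
    apply ball_subset_ball'
    have := mem_ball.1 hb
    linarith
  have hbr : b ∈ ball y r := ball_subset_ball (by linarith) hb
  have hab : a ∈ ball b (r / 2) := by
    have h1 := mem_ball.1 ha
    have h2 := mem_ball'.1 hb
    have := dist_triangle a y b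
    rw [mem_ball]; linarith
  have hmaps : MapsTo f (ball b (r / 2)) (closedBall (f b) (2 * M)) := by
    intro z hz
    rw [mem_closedBall, dist_eq_norm]
    have h1 := hM z (hsub hz)
    have h2 := hM b hbr
    have := norm_sub_le (f z) (f b)
    linarith
  have := Complex.dist_le_div_mul_dist_of_mapsTo_ball (hf.mono hsub) hmaps hab
  rw [dist_eq_norm, dist_eq_norm] at this
  refine this.trans (le_of_eq ?_)
  field_simp
  ring

theorem norm_fderiv_le_of_norm_le_on_ball {f : E → F} {y : E} {r M : ℝ} (hr : 0 < r)
    (hf : DifferentiableOn ℂ f (ball y r)) (hM : ∀ z ∈ ball y r, ‖f z‖ ≤ M) :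
    ‖fderiv ℂ f y‖ ≤ 2 * M / r := by
  refine Complex.norm_fderiv_le_div_of_mapsTo_ball hf (fun z hz => ?_) hr
  rw [mem_closedBall, dist_eq_norm]
  have h1 := hM z hz
  have h2 := hM y (mem_ball_self hr)
  have := norm_sub_le (f z) (f y)
  linarith

theorem exists_ball_norm_le {E F : Type*} [NormedAddCommGroup E] [NormedAddCommGroup F]
    {f : E → F} {U : Set E} (hU : IsOpen U)
    (hf : ContinuousOn f U) {p : E} (hp : p ∈ U) :
    ∃ r > 0, ball p r ⊆ U ∧ ∀ z ∈ ball p r, ‖f z‖ ≤ ‖f p‖ + 1 := by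
  have h1 : ∀ᶠ z in 𝓝 p, z ∈ U ∧ ‖f z‖ < ‖f p‖ + 1 :=
    Filter.Eventually.and (hU.mem_nhds hp)
      (((hf.continuousAt (hU.mem_nhds hp)).norm).eventually_lt_const (by linarith))
  obtain ⟨r, hr, h⟩ := Metric.eventually_nhds_iff_ball.1 h1
  exact ⟨r, hr, fun z hz => (h z hz).1, fun z hz => (h z hz).2.le⟩

theorem continuousOn_fderiv_complex {f : E → F} {U : Set E} (hU : IsOpen U)
    (hf : DifferentiableOn ℂ f U) : ContinuousOn (fderiv ℂ f) U := by
  intro p hp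
  apply ContinuousAt.continuousWithinAt
  obtain ⟨r, hr, hrU, hM⟩ := exists_ball_norm_le hU hf.continuousOn hp
  set M := ‖f p‖ + 1
  have hd := hf.mono hrU
  rw [Metric.continuousAt_iff]
  intro ε hε
  have hMpos : 0 < M := by positivity
  set C := 2 * (4 * M / r) / (r / 8)
  have hC : 0 < C := by positivity
  refine ⟨min (r / 8) (ε / C), by positivity, fun {q} hq => ?_⟩
  have hq1 : dist q p < r / 8 := hq.trans_le (min_le_left _ _)
  have hq2 : dist q p < ε / C := hq.trans_le (min_le_right _ _)
  rw [dist_eq_norm] at hq1 hq2 ⊢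
  set g : E → F := fun z => f (z + (q - p)) - f z
  have hmem : ∀ z ∈ ball p (r / 8), z + (q - p) ∈ ball p (r / 4) := by
    intro z hz
    rw [mem_ball, dist_eq_norm] at hz ⊢
    calc ‖z + (q - p) - p‖ = ‖(z - p) + (q - p)‖ := by congr 1; abel
      _ ≤ ‖z - p‖ + ‖q - p‖ := norm_add_le _ _
      _ < r / 4 := by linarith
  have hg : DifferentiableOn ℂ g (ball p (r / 8)) := by
    refine DifferentiableOn.sub ?_ (hd.mono (ball_subset_ball (by linarith)))
    refine hd.comp (by fun_prop) ?_
    intro z hz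
    exact ball_subset_ball (by linarith) (hmem z hz)
  have hgM : ∀ z ∈ ball p (r / 8), ‖g z‖ ≤ 4 * M / r * ‖q - p‖ := by
    intro z hz
    have := norm_sub_le_of_norm_le_on_ball hr hd hM (hmem z hz)
      (ball_subset_ball (by linarith) hz)
    simpa using this
  have key := norm_fderiv_le_of_norm_le_on_ball (by positivity) hg hgM
  have hfq : DifferentiableAt ℂ f q := (hd.differentiableAt (isOpen_ball.mem_nhds
    (by rw [mem_ball, dist_eq_norm]; linarith)))
  have hfp : DifferentiableAt ℂ f p := hd.differentiableAt (ball_mem_nhds _ hr)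
  have heq : fderiv ℂ g p = fderiv ℂ f q - fderiv ℂ f p := by
    have h1 : DifferentiableAt ℂ (fun z => f (z + (q - p))) p := by
      have : DifferentiableAt ℂ f (p + (q - p)) := by simpa using hfq
      exact this.comp p (by fun_prop)
    have : fderiv ℂ g p = fderiv ℂ (fun z => f (z + (q - p))) p - fderiv ℂ f p :=
      fderiv_sub h1 hfp
    rw [this, fderiv_comp_add_right]
    simp
  rw [← heq]
  refine key.trans_lt ?_
  rw [lt_div_iff₀ hC] at hq2
  calc 2 * (4 * M / r * ‖q - p‖) / (r / 8) = ‖q - p‖ * C := by simp only [C]; ring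
    _ < ε := hq2

theorem hasStrictFDerivAt_complex {f : E → F} {U : Set E} (hU : IsOpen U)
    (hf : DifferentiableOn ℂ f U) {p : E} (hp : p ∈ U) :
    HasStrictFDerivAt f (fderiv ℂ f p) p := by
  refine hasStrictFDerivAt_of_hasFDerivAt_of_continuousAt (f' := fderiv ℂ f) ?_
    ((continuousOn_fderiv_complex hU hf).continuousAt (hU.mem_nhds hp))
  filter_upwards [hU.mem_nhds hp] with z hz
  exact (hf.differentiableAt (hU.mem_nhds hz)).hasFDerivAt

theorem differentiableOn_fderiv_apply_complex [CompleteSpace F] {f : E → F} {U : Set E} (hU : IsOpen U)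
    (hf : DifferentiableOn ℂ f U) (v : E) : DifferentiableOn ℂ (fun z => fderiv ℂ f z v) U := by
  intro p hp
  apply DifferentiableAt.differentiableWithinAt
  obtain ⟨r', hr', hrU, hM⟩ := exists_ball_norm_le hU hf.continuousOn hp
  set M := ‖f p‖ + 1
  obtain ⟨r, hr, rfl⟩ : ∃ r : ℝ, 0 < r ∧ r' = 4 * r := ⟨r' / 4, by positivity, by ring⟩
  have hd := hf.mono hrU
  set ρ : ℝ := r / (‖v‖ + 1)
  have hρ : 0 < ρ := by positivity
  have hρv : ρ * ‖v‖ < r := by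
    have : ρ * (‖v‖ + 1) = r := div_mul_cancel₀ _ (by positivity)
    nlinarith
  have hmem : ∀ z ∈ ball p r, ∀ c ∈ closedBall (0 : ℂ) ρ, z + c • v ∈ ball p (2 * r) := by
    intro z hz c hc
    rw [mem_ball, dist_eq_norm] at hz ⊢
    rw [mem_closedBall, dist_zero_right] at hc
    calc ‖z + c • v - p‖ = ‖(z - p) + c • v‖ := by congr 1; abel
      _ ≤ ‖z - p‖ + ‖c‖ * ‖v‖ := by rw [← norm_smul]; exact norm_add_le _ _
      _ < 2 * r := by nlinarith [norm_nonneg v]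
  have hform : ∀ z ∈ ball p r, fderiv ℂ f z v =
      (2 * Real.pi * Complex.I : ℂ)⁻¹ • ∫ θ in (0 : ℝ)..2 * Real.pi,
        (deriv (circleMap 0 ρ) θ * ((circleMap 0 ρ θ) ^ 2)⁻¹) • f (z + circleMap 0 ρ θ • v) := by
    intro z hz
    have hzU : z ∈ ball p (4 * r) := ball_subset_ball (by linarith) hz
    have hline : HasDerivAt (fun c : ℂ => f (z + c • v)) (fderiv ℂ f z v) 0 := by
      have h1 : HasFDerivAt f (fderiv ℂ f z) (z + (0 : ℂ) • v) := by
        simpa using (hd.differentiableAt (isOpen_ball.mem_nhds hzU)).hasFDerivAt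
      have h2 : HasDerivAt (fun c : ℂ => z + c • v) v 0 := by
        simpa using ((hasDerivAt_id (0 : ℂ)).smul_const v).const_add z
      exact h1.comp_hasDerivAt _ h2
    have hdl : DifferentiableOn ℂ (fun c : ℂ => f (z + c • v)) (closedBall 0 ρ) := by
      refine hd.comp (by fun_prop) ?_
      intro c hc
      exact ball_subset_ball (by linarith) (hmem z hz c hc)
    have h3 := hdl.deriv_eq_smul_circleIntegral hρ
    rw [hline.deriv] at h3
    rw [eq_inv_smul_iff₀ Complex.two_pi_I_ne_zero, ← h3, circleIntegral]
    simp only [sub_zero, smul_smul, one_div]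
  have hbdd : ∀ z ∈ ball p (2 * r), ‖fderiv ℂ f z‖ ≤ 2 * M / r := by
    intro z hz
    have hs : ball z r ⊆ ball p (4 * r) := ball_subset_ball' (by have := mem_ball.1 hz; linarith)
    exact norm_fderiv_le_of_norm_le_on_ball hr (hd.mono hs) (fun w hw => hM w (hs hw))
  have hcirc : ∀ θ, circleMap 0 ρ θ ∈ closedBall (0 : ℂ) ρ := fun θ =>
    circleMap_mem_closedBall 0 hρ.le θ
  have hk : Continuous fun θ : ℝ => deriv (circleMap 0 ρ) θ * ((circleMap 0 ρ θ) ^ 2)⁻¹ := by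
    simp only [deriv_circleMap]
    refine Continuous.mul (by fun_prop) (Continuous.inv₀ (by fun_prop) ?_)
    intro θ
    exact pow_ne_zero _ (circleMap_ne_center hρ.ne')
  set k : ℝ → ℂ := fun θ => deriv (circleMap 0 ρ) θ * ((circleMap 0 ρ θ) ^ 2)⁻¹
  have hcontF : ∀ z ∈ ball p r, Continuous fun θ : ℝ => k θ • f (z + circleMap 0 ρ θ • v) := by
    intro z hz
    refine hk.smul ?_
    refine hd.continuousOn.comp_continuous (by fun_prop) (fun θ => ?_)
    exact ball_subset_ball (by linarith) (hmem z hz _ (hcirc θ))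
  have hcontF' : Continuous fun θ : ℝ => k θ • fderiv ℂ f (p + circleMap 0 ρ θ • v) := by
    refine hk.smul ?_
    refine (continuousOn_fderiv_complex isOpen_ball hd).comp_continuous (by fun_prop)
      (fun θ => ?_)
    exact ball_subset_ball (by linarith) (hmem p (mem_ball_self hr) _ (hcirc θ))
  have hint := intervalIntegral.hasFDerivAt_integral_of_dominated_of_fderiv_le
    (μ := MeasureTheory.volume) (a := 0) (b := 2 * Real.pi) (𝕜 := ℂ)
    (F := fun z θ => k θ • f (z + circleMap 0 ρ θ • v))
    (F' := fun z θ => k θ • fderiv ℂ f (z + circleMap 0 ρ θ • v)) (x₀ := p)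
    (bound := fun θ => ‖k θ‖ * (2 * M / r))
    (ball_mem_nhds p hr)
    (by
      filter_upwards [ball_mem_nhds p hr] with z hz
      exact (hcontF z hz).aestronglyMeasurable)
    ((hcontF p (mem_ball_self hr)).intervalIntegrable _ _)
    hcontF'.aestronglyMeasurable
    (by
      refine Eventually.of_forall fun θ _ z hz => ?_
      rw [norm_smul]
      gcongr
      exact hbdd _ (hmem z hz _ (hcirc θ)))
    ((hk.norm.mul continuous_const).intervalIntegrable _ _)
    (by
      refine Eventually.of_forall fun θ _ z hz => ?_
      have h1 : DifferentiableAt ℂ f (z + circleMap 0 ρ θ • v) := by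
        refine hd.differentiableAt (isOpen_ball.mem_nhds ?_)
        exact ball_subset_ball (by linarith) (hmem z hz _ (hcirc θ))
      have h2 := h1.hasFDerivAt
      rw [← hasFDerivAt_comp_add_right] at h2
      exact h2.const_smul (k θ))
  refine DifferentiableAt.congr_of_eventuallyEq
    (hint.differentiableAt.const_smul (2 * Real.pi * Complex.I : ℂ)⁻¹) ?_
  filter_upwards [ball_mem_nhds p hr] with z hz
  exact hform z hz

end Holomorphic

section Inverse

variable {E F : Type*} [NormedAddCommGroup E] [NormedSpace ℂ E] [NormedAddCommGroup F]
  [NormedSpace ℂ F] [FiniteDimensional ℂ E] [FiniteDimensional ℂ F]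

theorem exists_equiv_eq_fderiv {f : E → F} {p : E}
    (hdim : Module.finrank ℂ E = Module.finrank ℂ F)
    (h : ∀ v, fderiv ℂ f p v = 0 → v = 0) :
    ∃ e : E ≃L[ℂ] F, (e : E →L[ℂ] F) = fderiv ℂ f p := by
  have hinj : Function.Injective (fderiv ℂ f p : E →ₗ[ℂ] F) :=
    (injective_iff_map_eq_zero _).2 h
  refine ⟨(LinearMap.linearEquivOfInjective _ hinj hdim).toContinuousLinearEquiv, ?_⟩
  ext v
  simp

theorem map_nhds_and_inverse_differentiableAt {f : E → F} {U : Set E} (hU : IsOpen U)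
    (hf : DifferentiableOn ℂ f U) {G : F → E} (hG : ∀ z ∈ U, G (f z) = z) {p : E} (hp : p ∈ U)
    (hdim : Module.finrank ℂ E = Module.finrank ℂ F)
    (h : ∀ v, fderiv ℂ f p v = 0 → v = 0) :
    map f (𝓝 p) = 𝓝 (f p) ∧ DifferentiableAt ℂ G (f p) := by
  obtain ⟨e, he⟩ := exists_equiv_eq_fderiv hdim h
  have : CompleteSpace E := FiniteDimensional.complete ℂ E
  have hs := hasStrictFDerivAt_complex hU hf hp
  rw [← he] at hs
  refine ⟨hs.map_nhds_eq_of_equiv, ?_⟩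
  refine (HasStrictFDerivAt.to_local_left_inverse hs ?_).hasFDerivAt.differentiableAt
  filter_upwards [hU.mem_nhds hp] with z hz using hG z hz

end Inverse

section OneDim

theorem deriv_ne_zero_of_injOn {f : ℂ → ℂ} {U : Set ℂ} (hU : IsOpen U)
    (hf : DifferentiableOn ℂ f U) (hinj : InjOn f U) {p : ℂ} (hp : p ∈ U) : deriv f p ≠ 0 := by
  intro h0
  obtain ⟨r, hr, hrU⟩ := Metric.isOpen_iff.1 hU p hp
  have hball : ∀ z ∈ ball p r, DifferentiableAt ℂ f z := fun z hz =>
    hf.differentiableAt (hU.mem_nhds (hrU hz))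
  have han : ∀ z ∈ ball p r, AnalyticAt ℂ f z := fun z hz =>
    (hf.mono hrU).analyticAt (isOpen_ball.mem_nhds hz)
  have hne : ∀ z ∈ ball p r, ¬ ∀ᶠ w in 𝓝 z, f w = f z := by
    intro z hz hcon
    have h1 : ∀ᶠ w in 𝓝 z, w = z := by
      filter_upwards [hcon, isOpen_ball.mem_nhds hz] with w hw hw'
      exact hinj (hrU hw') (hrU hz) hw
    have h2 : ∀ᶠ w in 𝓝[≠] z, w = z := h1.filter_mono nhdsWithin_le_nhds
    have h3 : ∀ᶠ w in 𝓝[≠] z, w ≠ z := eventually_mem_nhdsWithin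
    obtain ⟨w, hw, hw'⟩ := (h2.and h3).exists
    exact hw' hw
  have hopen : ∀ z ∈ ball p r, 𝓝 (f z) ≤ map f (𝓝 z) := fun z hz =>
    ((han z hz).eventually_constant_or_nhds_le_map_nhds).resolve_left (hne z hz)
  set G := Function.invFunOn f (ball p r)
  have hinj' := hinj.mono hrU
  have hG : ∀ z ∈ ball p r, G (f z) = z := fun z hz => hinj'.leftInvOn_invFunOn hz
  have hGc : ContinuousAt G (f p) := by
    have hGp := hG p (mem_ball_self hr)
    rw [ContinuousAt, hGp]
    refine Tendsto.mono_left ?_ (hopen p (mem_ball_self hr))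
    rw [tendsto_map'_iff]
    refine Tendsto.congr' ?_ tendsto_id
    filter_upwards [ball_mem_nhds p hr] with z hz using (hG z hz).symm
  have hder : ∀ᶠ z in 𝓝[≠] p, deriv f z ≠ 0 := by
    have hana : AnalyticAt ℂ (deriv f) p := (han p (mem_ball_self hr)).deriv
    rcases hana.eventually_eq_zero_or_eventually_ne_zero with h | h
    · exfalso
      obtain ⟨s, hs, hs'⟩ := Metric.eventually_nhds_iff_ball.1 h
      apply hne p (mem_ball_self hr)
      filter_upwards [ball_mem_nhds p (lt_min hs hr)] with w hw
      have := isOpen_ball.is_const_of_deriv_eq_zero (𝕜 := ℂ) (convex_ball p (min s r)).isPreconnected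
        (f := f) (fun z hz => (hball z (ball_subset_ball (min_le_right _ _) hz)).differentiableWithinAt)
        (fun z hz => hs' z (ball_subset_ball (min_le_left _ _) hz)) hw (mem_ball_self (lt_min hs hr))
      exact this
    · exact h
  have hGd : ∀ᶠ w in 𝓝[≠] (f p), DifferentiableAt ℂ G w := by
    have h1 : ∀ᶠ z in 𝓝 p, z ∈ ball p r ∧ (z ≠ p → deriv f z ≠ 0) :=
      Filter.Eventually.and (ball_mem_nhds p hr) (eventually_nhdsWithin_iff.1 hder)
    have h2 : ∀ᶠ w in 𝓝 (f p), w ≠ f p → DifferentiableAt ℂ G w := by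
      apply hopen p (mem_ball_self hr)
      rw [mem_map]
      filter_upwards [h1] with z hz hzp
      have hzp' : z ≠ p := fun h => hzp (by rw [h])
      have hs := hasStrictFDerivAt_complex isOpen_ball (hf.mono hrU) hz.1
      have hs' : HasStrictDerivAt f (deriv f z) z := hs.hasStrictDerivAt
      exact (hs'.to_local_left_inverse (hz.2 hzp') (by
        filter_upwards [isOpen_ball.mem_nhds hz.1] with y hy using hG y hy)).hasDerivAt.differentiableAt
    exact eventually_nhdsWithin_iff.2 h2
  have hGan := Complex.analyticAt_of_differentiable_on_punctured_nhds_of_continuousAt hGd hGc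
  have hcomp : HasDerivAt (G ∘ f) (deriv G (f p) * deriv f p) p :=
    hGan.differentiableAt.hasDerivAt.comp p (hball p (mem_ball_self hr)).hasDerivAt
  have hid : HasDerivAt (G ∘ f) 1 p := by
    refine (hasDerivAt_id p).congr_of_eventuallyEq ?_
    filter_upwards [ball_mem_nhds p hr] with z hz using hG z hz
  have := hcomp.unique hid
  rw [h0, mul_zero] at this
  exact zero_ne_one this

end OneDim

section Straighten

variable {E : Type*} [NormedAddCommGroup E] [NormedSpace ℂ E] [FiniteDimensional ℂ E]

/-- Holomorphic coordinates in which a submersion to `ℂ` is affine. -/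
theorem exists_straightening {g : E → ℂ} {U : Set E} (hU : IsOpen U) (hg : DifferentiableOn ℂ g U)
    {p : E} (hp : p ∈ U) {u : E} (hu : fderiv ℂ g p u = 1) :
    ∃ G : E → E, ∃ r > 0, G 0 = p ∧ DifferentiableOn ℂ G (ball 0 r) ∧ MapsTo G (ball 0 r) U ∧
      (∀ w ∈ ball 0 r, g (G w) = g p + fderiv ℂ g p w) ∧ InjOn G (ball 0 r) ∧
      HasFDerivAt G (ContinuousLinearMap.id ℂ E) 0 := by
  have : CompleteSpace E := FiniteDimensional.complete ℂ E
  set l := fderiv ℂ g p with hl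
  set H : E → E := fun z => z + (g z - g p - l (z - p)) • u with hH
  have hHd : DifferentiableOn ℂ H U := by
    refine differentiableOn_id.add (DifferentiableOn.smul_const ?_ u)
    refine (hg.sub_const _).sub ?_
    exact (l.differentiable.comp (differentiable_id.sub_const p)).differentiableOn
  have hHp : HasFDerivAt H (ContinuousLinearMap.id ℂ E) p := by
    have h1 : HasFDerivAt g l p := (hg.differentiableAt (hU.mem_nhds hp)).hasFDerivAt
    have h2 : HasFDerivAt (fun z => l (z - p)) l p := by
      simpa using (l.hasFDerivAt (x := p)).sub_const (l p)
    have h3 := (hasFDerivAt_id (𝕜 := ℂ) p).add (((h1.sub_const (g p)).sub h2).smul_const u)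
    refine h3.congr_fderiv ?_
    ext v; simp
  have hHs : HasStrictFDerivAt H ((ContinuousLinearEquiv.refl ℂ E : E ≃L[ℂ] E) : E →L[ℂ] E) p := by
    have := hasStrictFDerivAt_complex hU hHd hp
    rw [hHp.fderiv] at this
    exact this
  set S := hHs.toOpenPartialHomeomorph H
  have hSp : p ∈ S.source := hHs.mem_toOpenPartialHomeomorph_source
  have hHpp : H p = p := by simp [hH]
  set I := S.symm
  have hpt : p ∈ S.target := by
    have := S.map_source hSp
    rwa [show S p = H p from rfl, hHpp] at this
  have hIp : S.symm p = p := by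
    have := S.left_inv hSp
    rwa [show S p = H p from rfl, hHpp] at this
  have hev1 : ∀ᶠ w in 𝓝 p, w ∈ S.target := S.open_target.mem_nhds hpt
  have hIc : ContinuousAt S.symm p := S.symm.continuousAt hpt
  have hHstrict : ∀ᶠ z in 𝓝 p, z ∈ U ∧ ∃ e : E ≃L[ℂ] E, (e : E →L[ℂ] E) = fderiv ℂ H z := by
    have h1 : ContinuousAt (fderiv ℂ H) p :=
      (continuousOn_fderiv_complex hU hHd).continuousAt (hU.mem_nhds hp)
    have h2 : range ((↑) : (E ≃L[ℂ] E) → (E →L[ℂ] E)) ∈ 𝓝 (fderiv ℂ H p) := by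
      rw [hHp.fderiv]
      exact (ContinuousLinearEquiv.refl ℂ E).nhds
    filter_upwards [hU.mem_nhds hp, h1 h2] with z hz hz'
    exact ⟨hz, hz'⟩
  have hev2 : ∀ᶠ w in 𝓝 p, S.symm w ∈ U ∧ ∃ e : E ≃L[ℂ] E, (e : E →L[ℂ] E) = fderiv ℂ H (S.symm w) := by
    have := hIc.tendsto
    rw [hIp] at this
    exact this hHstrict
  obtain ⟨r, hr, hball⟩ := Metric.eventually_nhds_iff_ball.1 (hev1.and hev2)
  have hmem : ∀ w ∈ ball (0 : E) r, p + w ∈ ball p r := by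
    intro w hw; simpa using hw
  have hright : ∀ w ∈ ball (0 : E) r, H (S.symm (p + w)) = p + w := fun w hw =>
    S.right_inv (hball _ (hmem w hw)).1
  have hIdiff : ∀ w ∈ ball (0 : E) r, ∃ e : E ≃L[ℂ] E, (e : E →L[ℂ] E) = fderiv ℂ H (S.symm (p + w)) ∧
      HasFDerivAt (fun w => S.symm (p + w)) (e.symm : E →L[ℂ] E) w := by
    intro w hw
    obtain ⟨ht, hu', e, he⟩ := hball _ (hmem w hw)
    refine ⟨e, he, ?_⟩
    have h1 : HasFDerivAt H (e : E →L[ℂ] E) (S.symm (p + w)) := by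
      rw [he]; exact (hHd.differentiableAt (hU.mem_nhds hu')).hasFDerivAt
    have h2 : HasFDerivAt S.symm (e.symm : E →L[ℂ] E) (p + w) :=
      S.hasFDerivAt_symm ht h1
    exact (hasFDerivAt_comp_add_left p).2 h2
  refine ⟨fun w => S.symm (p + w), r, hr, by simpa using hIp, ?_, ?_, ?_, ?_, ?_⟩
  · intro w hw
    obtain ⟨e, -, he⟩ := hIdiff w hw
    exact he.differentiableAt.differentiableWithinAt
  · intro w hw
    exact (hball _ (hmem w hw)).2.1
  · intro w hw
    have h1 := congrArg l (hright w hw)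
    simp only [hH, map_add, map_smul, map_sub, smul_eq_mul, hu] at h1
    linear_combination h1
  · intro a ha b hb hab
    have h1 := hright a ha
    have h2 := hright b hb
    simp only at hab
    rw [hab, h2] at h1
    exact (add_left_cancel h1).symm
  · obtain ⟨e, he, h⟩ := hIdiff 0 (mem_ball_self hr)
    refine h.congr_fderiv ?_
    rw [add_zero, hIp, hHp.fderiv] at he
    ext v
    have : e (e.symm v) = (ContinuousLinearMap.id ℂ E) (e.symm v) := by rw [← he]; rfl
    simpa using this.symm

end Straighten

section Osgood

variable {E F : Type*} [NormedAddCommGroup E] [NormedSpace ℂ E] [NormedAddCommGroup F]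
  [NormedSpace ℂ F] [FiniteDimensional ℂ E] [FiniteDimensional ℂ F]

theorem exists_jacobian {f : E → F} {U : Set E} (hU : IsOpen U) (hf : DifferentiableOn ℂ f U)
    (hdim : Module.finrank ℂ E = Module.finrank ℂ F) :
    ∃ J : E → ℂ, DifferentiableOn ℂ J U ∧ ∀ z, J z = 0 ↔ ∃ v, v ≠ 0 ∧ fderiv ℂ f z v = 0 := by
  have : CompleteSpace F := FiniteDimensional.complete ℂ F
  let b := Module.finBasis ℂ E
  let b' := Module.finBasisOfFinrankEq ℂ F hdim.symm
  let A : E → Matrix (Fin (Module.finrank ℂ E)) (Fin (Module.finrank ℂ E)) ℂ := fun z =>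
    LinearMap.toMatrix b b' (fderiv ℂ f z : E →ₗ[ℂ] F)
  refine ⟨fun z => (A z).det, ?_, fun z => ?_⟩
  · simp only [Matrix.det_apply]
    refine DifferentiableOn.fun_sum fun σ _ => ?_
    refine DifferentiableOn.const_smul ?_ _
    suffices h : ∀ i, DifferentiableOn ℂ (fun z => A z (σ i) i) U from fun z hz =>
      (HasFDerivWithinAt.finsetProd fun i _ =>
        (h i z hz).hasFDerivWithinAt).differentiableWithinAt
    intro i
    simp only [A, LinearMap.toMatrix_apply]
    have h1 := differentiableOn_fderiv_apply_complex hU hf (b i)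
    have h2 : Differentiable ℂ fun x : F => b'.repr x (σ i) :=
      (LinearMap.toContinuousLinearMap (b'.coord (σ i))).differentiable
    exact h2.comp_differentiableOn h1
  · show (A z).det = 0 ↔ _
    rw [← Matrix.exists_mulVec_eq_zero_iff]
    constructor
    · rintro ⟨v, hv, h⟩
      refine ⟨b.equivFun.symm v, (b.equivFun.symm.map_ne_zero_iff).2 hv, ?_⟩
      have h1 := LinearMap.toMatrix_mulVec_repr b b' (fderiv ℂ f z : E →ₗ[ℂ] F) (b.equivFun.symm v)
      have h2 : (⇑(b.repr (b.equivFun.symm v)) : Fin (Module.finrank ℂ E) → ℂ) = v := by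
        rw [← b.equivFun_apply, LinearEquiv.apply_symm_apply]
      rw [h2] at h1
      have h3 : b'.equivFun (fderiv ℂ f z (b.equivFun.symm v)) = 0 := by
        rw [b'.equivFun_apply]
        exact h1.symm.trans h
      exact (LinearEquiv.map_eq_zero_iff _).1 h3
    · rintro ⟨v, hv, h⟩
      refine ⟨b.equivFun v, by simpa using hv, ?_⟩
      have h1 := LinearMap.toMatrix_mulVec_repr b b' (fderiv ℂ f z : E →ₗ[ℂ] F) v
      rw [b.equivFun_apply]
      refine h1.trans ?_
      ext i
      simp [h]

theorem fderiv_eq_zero_of_vanishing {f : E → F} {U : Set E} (hU : IsOpen U)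
    (hf : DifferentiableOn ℂ f U) (hinj : InjOn f U)
    (hdim : Module.finrank ℂ E = Module.finrank ℂ F) (h2 : 2 ≤ Module.finrank ℂ E)
    (hdich : ∀ p ∈ U, (∃ k, k ≠ 0 ∧ fderiv ℂ f p k = 0) → fderiv ℂ f p = 0)
    {g : E → ℂ} (hg : DifferentiableOn ℂ g U)
    (hgZ : ∀ z ∈ U, fderiv ℂ f z = 0 → g z = 0) {q : E} (hq : q ∈ U) (hqZ : fderiv ℂ f q = 0) :
    fderiv ℂ g q = 0 := by
  by_contra hne
  obtain ⟨u₀, hu₀⟩ : ∃ u, fderiv ℂ g q u ≠ 0 := by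
    by_contra! h
    exact hne (ContinuousLinearMap.ext h)
  obtain ⟨u, hu⟩ : ∃ u, fderiv ℂ g q u = 1 :=
    ⟨(fderiv ℂ g q u₀)⁻¹ • u₀, by simp [hu₀]⟩
  obtain ⟨G, r, hr, hG0, hGd, hGm, hGl, hGi, -⟩ := exists_straightening hU hg hq hu
  set l := fderiv ℂ g q
  have hgq : g q = 0 := hgZ q hq hqZ
  obtain ⟨J, hJd, hJ⟩ := exists_jacobian hU hf hdim
  have hnontriv : Nontrivial E := Module.nontrivial_of_finrank_pos (R := ℂ) (by omega)
  set j : E → ℂ := fun w => J (G w) with hj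
  have hjd : DifferentiableOn ℂ j (ball 0 r) := hJd.comp hGd hGm
  have hjl : ∀ w ∈ ball 0 r, j w = 0 → l w = 0 := by
    intro w hw h
    have h1 := hdich _ (hGm hw) ((hJ _).1 h)
    have h2 := hgZ _ (hGm hw) h1
    have h3 := hGl w hw
    rw [h2, hgq, zero_add] at h3
    exact h3.symm
  have hj0 : j 0 = 0 := by
    obtain ⟨k, hk⟩ := exists_ne (0 : E)
    refine (hJ _).2 ⟨k, hk, ?_⟩
    rw [hG0, hqZ]; rfl
  set ρ : ℝ := r / 2 / (‖u‖ + 1)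
  have hρ : 0 < ρ := by positivity
  have hρu : ρ * ‖u‖ < r / 2 := by
    have : ρ * (‖u‖ + 1) = r / 2 := div_mul_cancel₀ _ (by positivity)
    nlinarith
  have hmem : ∀ w : E, ‖w‖ < r / 2 → ∀ c ∈ closedBall (0 : ℂ) ρ, w + c • u ∈ ball (0 : E) r := by
    intro w hw c hc
    rw [mem_closedBall, dist_zero_right] at hc
    rw [mem_ball, dist_zero_right]
    calc ‖w + c • u‖ ≤ ‖w‖ + ‖c‖ * ‖u‖ := by rw [← norm_smul]; exact norm_add_le _ _
      _ < r := by nlinarith [norm_nonneg u]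
  have hcirc : ∀ c ∈ sphere (0 : ℂ) ρ, 0 < ‖j (c • u)‖ := by
    intro c hc
    rw [norm_pos_iff]
    intro h
    have h1 := hmem 0 (by simpa using half_pos hr) c (sphere_subset_closedBall hc)
    rw [zero_add] at h1
    have h2 := hjl _ h1 h
    rw [map_smul, hu, smul_eq_mul, mul_one] at h2
    rw [h2] at hc
    simp at hc
    exact hρ.ne hc
  have hjcont : ∀ w ∈ ball (0 : E) r, ContinuousAt j w := fun w hw =>
    hjd.continuousOn.continuousAt (isOpen_ball.mem_nhds hw)
  obtain ⟨c₀, hc₀, hmin⟩ : ∃ c₀ ∈ sphere (0 : ℂ) ρ, IsMinOn (fun c => ‖j (c • u)‖) (sphere 0 ρ) c₀ := by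
    refine (isCompact_sphere 0 ρ).exists_isMinOn ((NormedSpace.sphere_nonempty).2 hρ.le) ?_
    intro c hc
    refine ContinuousAt.continuousWithinAt (ContinuousAt.norm ?_)
    have h1 := hmem 0 (by simpa using half_pos hr) c (sphere_subset_closedBall hc)
    rw [zero_add] at h1
    exact ContinuousAt.comp (f := fun c : ℂ => c • u) (hjcont _ h1) (by fun_prop)
  set m := ‖j (c₀ • u)‖
  have hm : 0 < m := hcirc c₀ hc₀
  have hev1 : ∀ᶠ w in 𝓝 (0 : E), ∀ c ∈ sphere (0 : ℂ) ρ, m / 2 < ‖j (w + c • u)‖ := by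
    apply (isCompact_sphere 0 ρ).eventually_forall_of_forall_eventually
    intro c hc
    have h1 := hmem 0 (by simpa using half_pos hr) c (sphere_subset_closedBall hc)
    have h2 : ContinuousAt (fun x : E × ℂ => ‖j (x.1 + x.2 • u)‖) (0, c) := by
      refine ContinuousAt.norm ?_
      exact ContinuousAt.comp (f := fun x : E × ℂ => x.1 + x.2 • u) (hjcont _ h1) (by fun_prop)
    refine h2.eventually_const_lt ?_
    have : m ≤ ‖j (c • u)‖ := hmin hc
    simp only [zero_add]
    linarith
  have hev2 : ∀ᶠ w in 𝓝 (0 : E), ‖j w‖ < m / 2 := by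
    refine (hjcont 0 (mem_ball_self hr)).norm.eventually_lt_const ?_
    simp only [hj0, norm_zero]; positivity
  have hev3 : ∀ᶠ w in 𝓝 (0 : E), ‖w‖ < r / 2 := by
    filter_upwards [ball_mem_nhds (0 : E) (half_pos hr)] with w hw
    simpa using hw
  obtain ⟨s, hs, hball⟩ := Metric.eventually_nhds_iff_ball.1 (hev1.and (hev2.and hev3))
  have hzero : ∀ w ∈ ball (0 : E) s, l w = 0 → j w = 0 := by
    intro w hw hlw
    by_contra hjw
    obtain ⟨hw1, hw2, hw3⟩ := hball w hw
    have hnz : ∀ c ∈ closedBall (0 : ℂ) ρ, j (w + c • u) ≠ 0 := by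
      intro c hc h
      have h1 := hjl _ (hmem w hw3 c hc) h
      rw [map_add, hlw, map_smul, hu, smul_eq_mul, mul_one, zero_add] at h1
      rw [h1, zero_smul, add_zero] at h
      exact hjw h
    have hdiff : DifferentiableOn ℂ (fun c : ℂ => (j (w + c • u))⁻¹) (closedBall 0 ρ) := by
      refine DifferentiableOn.inv ?_ hnz
      exact hjd.comp (by fun_prop) (fun c hc => hmem w hw3 c hc)
    have hmax := Complex.norm_le_of_forall_mem_frontier_norm_le (f := fun c : ℂ => (j (w + c • u))⁻¹)
      (U := ball 0 ρ) isBounded_ball (C := (m / 2)⁻¹)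
      (hdiff.diffContOnCl_ball Subset.rfl) (by
        intro c hc
        rw [frontier_ball _ hρ.ne'] at hc
        rw [norm_inv]
        exact inv_anti₀ (by positivity) (hw1 c hc).le)
      (subset_closure (mem_ball_self hρ))
    simp only [zero_smul, add_zero, norm_inv] at hmax
    rw [inv_le_inv₀ (norm_pos_iff.2 hjw) (by positivity)] at hmax
    linarith
  obtain ⟨w₁, hw₁, hlw₁⟩ : ∃ w, w ≠ 0 ∧ l w = 0 := by
    by_contra! hcon
    have hli : Function.Injective (l : E →ₗ[ℂ] ℂ) := by
      refine (injective_iff_map_eq_zero _).2 fun w hw => ?_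
      by_contra hw0
      exact hcon w hw0 hw
    have := LinearMap.finrank_le_finrank_of_injective hli
    simp at this
    omega
  have hmin_pos : 0 < min s r := lt_min hs hr
  obtain ⟨w, hw, hlw, hws⟩ : ∃ w : E, w ≠ 0 ∧ l w = 0 ∧ ‖w‖ < min s r := by
    have hpos : 0 < min s r / 2 / ‖w₁‖ := by
      have := norm_pos_iff.2 hw₁
      positivity
    refine ⟨((min s r / 2 / ‖w₁‖ : ℝ) : ℂ) • w₁, ?_, by simp [hlw₁], ?_⟩
    · exact smul_ne_zero (by exact_mod_cast hpos.ne') hw₁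
    · rw [norm_smul, Complex.norm_real, Real.norm_of_nonneg hpos.le, div_mul_cancel₀ _ (norm_ne_zero_iff.2 hw₁)]
      linarith
  have hcw : ∀ c ∈ ball (0 : ℂ) 1, ‖c • w‖ < min s r := by
    intro c hc
    rw [mem_ball, dist_zero_right] at hc
    rw [norm_smul]
    nlinarith [norm_nonneg w]
  have hcwr : ∀ c ∈ ball (0 : ℂ) 1, c • w ∈ ball (0 : E) r := fun c hc => by
    simpa using (hcw c hc).trans_le (min_le_right _ _)
  have hder : ∀ c ∈ ball (0 : ℂ) 1, HasDerivAt (fun c : ℂ => f (G (c • w))) 0 c := by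
    intro c hc
    have h1 : fderiv ℂ f (G (c • w)) = 0 := by
      refine hdich _ (hGm (hcwr c hc)) ((hJ _).1 (hzero _ ?_ (by simp [hlw])))
      simpa using (hcw c hc).trans_le (min_le_left _ _)
    have h2 : HasFDerivAt f (0 : E →L[ℂ] F) (G (c • w)) := by
      rw [← h1]
      exact (hf.differentiableAt (hU.mem_nhds (hGm (hcwr c hc)))).hasFDerivAt
    have h3 : DifferentiableAt ℂ (fun c : ℂ => G (c • w)) c := by
      refine DifferentiableAt.comp (f := fun c : ℂ => c • w) c ?_ (by fun_prop)
      exact hGd.differentiableAt (isOpen_ball.mem_nhds (hcwr c hc))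
    exact h2.comp_hasDerivAt c h3.hasDerivAt
  have hhalf : (2⁻¹ : ℂ) ∈ ball (0 : ℂ) 1 := by simp; norm_num
  have hconst := isOpen_ball.is_const_of_deriv_eq_zero (𝕜 := ℂ) (convex_ball (0 : ℂ) 1).isPreconnected
    (fun c hc => (hder c hc).differentiableAt.differentiableWithinAt)
    (fun c hc => (hder c hc).deriv) hhalf (mem_ball_self one_pos)
  have h1 := hinj (hGm (hcwr _ hhalf)) (hGm (hcwr _ (mem_ball_self one_pos))) hconst
  have h2 := hGi (hcwr _ hhalf) (hcwr _ (mem_ball_self one_pos)) h1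
  rw [zero_smul, smul_eq_zero] at h2
  rcases h2 with h2 | h2
  · norm_num at h2
  · exact hw h2

/-- `directionalIterate f k j` is the `j`-th derivative of `f` in the direction `k`. -/
def directionalIterate (f : E → F) (k : E) : ℕ → E → F
  | 0 => f
  | j + 1 => fun z => fderiv ℂ (directionalIterate f k j) z k

theorem injective_fderiv_of_dichotomy {f : E → F} {U : Set E} (hU : IsOpen U)
    (hf : DifferentiableOn ℂ f U) (hinj : InjOn f U)
    (hdim : Module.finrank ℂ E = Module.finrank ℂ F) (h2 : 2 ≤ Module.finrank ℂ E)
    (hdich : ∀ p ∈ U, (∃ k, k ≠ 0 ∧ fderiv ℂ f p k = 0) → fderiv ℂ f p = 0)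
    {p : E} (hp : p ∈ U) {k : E} (hk : fderiv ℂ f p k = 0) : k = 0 := by
  have : CompleteSpace F := FiniteDimensional.complete ℂ F
  by_contra hk0
  have hpZ := hdich p hp ⟨k, hk0, hk⟩
  have hgd : ∀ j, DifferentiableOn ℂ (directionalIterate f k j) U := by
    intro j
    induction j with
    | zero => exact hf
    | succ j ih => exact differentiableOn_fderiv_apply_complex hU ih k
  have hgz : ∀ j, ∀ q ∈ U, fderiv ℂ f q = 0 → fderiv ℂ (directionalIterate f k j) q = 0 := by
    intro j
    induction j with
    | zero => exact fun q _ h => h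
    | succ j ih =>
      intro q hq hqZ
      ext v
      refine SeparatingDual.eq_zero_of_forall_dual_eq_zero (R := ℂ) fun ψ => ?_
      have h1 := fderiv_eq_zero_of_vanishing hU hf hinj hdim h2 hdich
        (g := fun z => ψ (directionalIterate f k (j + 1) z))
        (ψ.differentiable.comp_differentiableOn (hgd (j + 1)))
        (fun z hz hzZ => by
          show ψ (fderiv ℂ (directionalIterate f k j) z k) = 0
          rw [ih z hz hzZ]; simp) hq hqZ
      have h3 : HasFDerivAt (fun z => ψ (directionalIterate f k (j + 1) z))
          (ψ.comp (fderiv ℂ (directionalIterate f k (j + 1)) q)) q :=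
        ψ.hasFDerivAt.comp q ((hgd (j + 1)).differentiableAt (hU.mem_nhds hq)).hasFDerivAt
      rw [h3.fderiv] at h1
      simpa using congrArg (fun T => T v) h1
  obtain ⟨r', hr', hrU⟩ := Metric.isOpen_iff.1 hU p hp
  set ρ : ℝ := r' / (‖k‖ + 1)
  have hρ : 0 < ρ := by positivity
  have hmem : ∀ c ∈ ball (0 : ℂ) ρ, p + c • k ∈ U := by
    intro c hc
    apply hrU
    rw [mem_ball, dist_zero_right] at hc
    have : ρ * (‖k‖ + 1) = r' := div_mul_cancel₀ _ (by positivity)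
    rw [mem_ball, dist_eq_norm, add_sub_cancel_left, norm_smul]
    nlinarith [norm_nonneg k]
  have hline : ∀ j, ∀ c ∈ ball (0 : ℂ) ρ,
      HasDerivAt (fun c : ℂ => directionalIterate f k j (p + c • k))
        (directionalIterate f k (j + 1) (p + c • k)) c := by
    intro j c hc
    have h1 := ((hgd j).differentiableAt (hU.mem_nhds (hmem c hc))).hasFDerivAt
    have h2 : HasDerivAt (fun c : ℂ => p + c • k) k c := by
      simpa using ((hasDerivAt_id c).smul_const k).const_add p
    exact h1.comp_hasDerivAt c h2
  set h : ℂ → F := fun c => f (p + c • k)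
  have hit : ∀ j, ∀ c ∈ ball (0 : ℂ) ρ, iteratedDeriv j h c = directionalIterate f k j (p + c • k) := by
    intro j
    induction j with
    | zero => intro c _; rw [iteratedDeriv_zero]; rfl
    | succ j ih =>
      intro c hc
      rw [iteratedDeriv_succ]
      have : iteratedDeriv j h =ᶠ[𝓝 c] fun c : ℂ => directionalIterate f k j (p + c • k) := by
        filter_upwards [isOpen_ball.mem_nhds hc] with d hd using ih d hd
      rw [this.deriv_eq]
      exact (hline j c hc).deriv
  have hhd : DifferentiableOn ℂ h (ball 0 ρ) := fun c hc =>
    (hline 0 c hc).differentiableAt.differentiableWithinAt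
  have hconst : ∀ c ∈ ball (0 : ℂ) ρ, h c = h 0 := by
    intro c hc
    have hsum := Complex.hasSum_taylorSeries_on_ball (r := ρ) (c := 0) (f := h)
      hhd (z := c) hc
    refine hsum.unique ?_
    have h0 : ∀ j, j ≠ 0 → ((j.factorial : ℂ)⁻¹ • (c - 0) ^ j • iteratedDeriv j h 0) = 0 := by
      intro j hj
      obtain ⟨i, rfl⟩ := Nat.exists_eq_succ_of_ne_zero hj
      rw [hit _ _ (mem_ball_self hρ)]
      have : directionalIterate f k (i + 1) (p + (0 : ℂ) • k) = 0 := by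
        rw [zero_smul, add_zero]
        show fderiv ℂ (directionalIterate f k i) p k = 0
        rw [hgz i p hp hpZ]; rfl
      rw [this, smul_zero, smul_zero]
    have := hasSum_single (f := fun j : ℕ => ((j.factorial : ℂ)⁻¹ • (c - 0) ^ j • iteratedDeriv j h 0))
      0 (fun j hj => h0 j hj)
    simpa using this
  have hc : ((ρ / 2 : ℝ) : ℂ) ∈ ball (0 : ℂ) ρ := by
    rw [mem_ball, dist_zero_right, Complex.norm_real, Real.norm_of_nonneg (by positivity)]
    linarith
  have := hinj (hmem _ hc) (hmem _ (mem_ball_self hρ)) (hconst _ hc)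
  have h3 : ((ρ / 2 : ℝ) : ℂ) • k = 0 := by simpa using this
  rw [smul_eq_zero] at h3
  rcases h3 with h3 | h3
  · exact (half_pos hρ).ne' (by exact_mod_cast h3)
  · exact hk0 h3

end Osgood

section OsgoodMain

universe u v

theorem injective_fderiv_of_finrank_one {E : Type u} {F : Type v} [NormedAddCommGroup E]
    [NormedSpace ℂ E] [NormedAddCommGroup F] [NormedSpace ℂ F] [FiniteDimensional ℂ E]
    [FiniteDimensional ℂ F] (hE : Module.finrank ℂ E = 1) (hF : Module.finrank ℂ F = 1)
    {f : E → F} {U : Set E} (hU : IsOpen U) (hf : DifferentiableOn ℂ f U) (hinj : InjOn f U)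
    {p : E} (hp : p ∈ U) {k : E} (hk : fderiv ℂ f p k = 0) : k = 0 := by
  let e : ℂ ≃L[ℂ] E := ContinuousLinearEquiv.ofFinrankEq (by simp [hE])
  let e' : F ≃L[ℂ] ℂ := ContinuousLinearEquiv.ofFinrankEq (by simp [hF])
  have hd : DifferentiableOn ℂ (fun c => e' (f (e c))) (e ⁻¹' U) :=
    e'.differentiable.comp_differentiableOn (hf.comp e.differentiable.differentiableOn fun _ h => h)
  have hi : InjOn (fun c => e' (f (e c))) (e ⁻¹' U) := fun a ha b hb h =>
    e.injective (hinj ha hb (e'.injective h))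
  have hp' : e.symm p ∈ e ⁻¹' U := by simpa using hp
  have hne := deriv_ne_zero_of_injOn (hU.preimage e.continuous) hd hi hp'
  have h1 : HasFDerivAt f (fderiv ℂ f p) (e (e.symm p)) := by
    rw [e.apply_symm_apply]
    exact (hf.differentiableAt (hU.mem_nhds hp)).hasFDerivAt
  have h2 : HasFDerivAt (fun c => e' (f (e c)))
      ((e' : F →L[ℂ] ℂ).comp ((fderiv ℂ f p).comp (e : ℂ →L[ℂ] E))) (e.symm p) :=
    e'.hasFDerivAt.comp _ (h1.comp _ e.hasFDerivAt)
  have h3 : deriv (fun c => e' (f (e c))) (e.symm p) = e' (fderiv ℂ f p (e 1)) := by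
    rw [h2.hasDerivAt.deriv]; rfl
  have h4 : k = (e.symm k) • e 1 := by
    rw [← map_smul]; simp
  by_contra hk0
  rw [h4, map_smul, smul_eq_zero] at hk
  rcases hk with hk | hk
  · simp at hk; exact hk0 hk
  · rw [h3, hk, map_zero] at hne
    exact hne rfl

theorem injective_fderiv_of_injOn (n : ℕ) : ∀ {E : Type u} {F : Type v} [NormedAddCommGroup E]
    [NormedSpace ℂ E] [NormedAddCommGroup F] [NormedSpace ℂ F] [FiniteDimensional ℂ E]
    [FiniteDimensional ℂ F] (_ : Module.finrank ℂ E = n) (_ : Module.finrank ℂ F = n)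
    {f : E → F} {U : Set E} (_ : IsOpen U) (_ : DifferentiableOn ℂ f U) (_ : InjOn f U)
    {p : E} (_ : p ∈ U) {k : E} (_ : fderiv ℂ f p k = 0), k = 0 := by
  induction n with
  | zero =>
    intro E F _ _ _ _ _ _ hE hF f U hU hf hinj p hp k hk
    have := Module.finrank_zero_iff.1 hE
    exact Subsingleton.elim _ _
  | succ n ih =>
    intro E F _ _ _ _ _ _ hE hF f U hU hf hinj p hp k hk
    rcases Nat.eq_zero_or_pos n with rfl | hn
    · exact injective_fderiv_of_finrank_one hE hF hU hf hinj hp hk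
    refine injective_fderiv_of_dichotomy hU hf hinj (hE.trans hF.symm) (by omega) ?_ hp hk
    clear! p k
    rintro p hp ⟨k, hk0, hk⟩
    by_contra hne
    obtain ⟨u, hu⟩ : ∃ u, fderiv ℂ f p u ≠ 0 := by
      by_contra! h
      exact hne (ContinuousLinearMap.ext h)
    set t := fderiv ℂ f p u with ht
    obtain ⟨φ, hφ⟩ := SeparatingDual.exists_eq_one (R := ℂ) hu
    have hfp := (hf.differentiableAt (hU.mem_nhds hp)).hasFDerivAt
    have hgp : HasFDerivAt (fun z => φ (f z)) (φ.comp (fderiv ℂ f p)) p := φ.hasFDerivAt.comp p hfp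
    have hgu : fderiv ℂ (fun z => φ (f z)) p u = 1 := by
      rw [hgp.fderiv]; exact hφ
    obtain ⟨G, r, hr, hG0, hGd, hGm, hGl, hGi, hG1⟩ := exists_straightening
      (g := fun z => φ (f z)) hU (φ.differentiable.comp_differentiableOn hf) hp hgu
    rw [hgp.fderiv] at hGl
    set l := φ.comp (fderiv ℂ f p) with hl
    let A : Submodule ℂ E := LinearMap.ker (l : E →ₗ[ℂ] ℂ)
    let B : Submodule ℂ F := LinearMap.ker (φ : F →ₗ[ℂ] ℂ)
    have hA : Module.finrank ℂ A = n := by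
      have := Module.Dual.finrank_ker_add_one_of_ne_zero (f := (l : E →ₗ[ℂ] ℂ)) (by
        intro h
        have : l u = 0 := by
          have := congrArg (fun T => T u) h
          simpa using this
        rw [hl, ContinuousLinearMap.comp_apply, hφ] at this
        exact one_ne_zero this)
      rw [hE] at this
      exact Nat.succ_injective this
    have hB : Module.finrank ℂ B = n := by
      have := Module.Dual.finrank_ker_add_one_of_ne_zero (f := (φ : F →ₗ[ℂ] ℂ)) (by
        intro h
        have : φ t = 0 := by
          have := congrArg (fun T => T t) h
          simpa using this
        rw [hφ] at this
        exact one_ne_zero this)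
      rw [hF] at this
      exact Nat.succ_injective this
    let π : F →L[ℂ] B := (ContinuousLinearMap.id ℂ F - φ.smulRight t).codRestrict B (fun x => by
      simp [B, hφ])
    have hπ : ∀ x, ((π x : B) : F) = x - φ x • t := fun x => by
      simp [π]
    have hval : ∀ y : A, y ∈ ball (0 : A) r → (y : E) ∈ ball (0 : E) r := fun y hy => by
      simpa using hy
    have hφ0 : ∀ y : A, y ∈ ball (0 : A) r → φ (f (G y)) = φ (f p) := by
      intro y hy
      have h1 : l (y : E) = 0 := y.2
      have h2 := hGl _ (hval y hy)
      rw [h1, add_zero] at h2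
      exact h2
    have hd : DifferentiableOn ℂ (fun y : A => π (f (G y))) (ball 0 r) := by
      refine π.differentiable.comp_differentiableOn (hf.comp (t := U) ?_ fun y hy => hGm (hval y hy))
      exact hGd.comp (f := fun y : A => (y : E)) A.subtypeL.differentiable.differentiableOn hval
    have hi : InjOn (fun y : A => π (f (G y))) (ball 0 r) := by
      intro a ha b hb hab
      have h1 := congrArg (fun x : B => (x : F)) hab
      simp only [hπ, hφ0 a ha, hφ0 b hb] at h1
      have h2 := hinj (hGm (hval a ha)) (hGm (hval b hb)) (sub_left_injective h1)
      exact Subtype.ext (hGi (hval a ha) (hval b hb) h2)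
    have hkA : k ∈ A := by
      show φ (fderiv ℂ f p k) = 0
      rw [hk, map_zero]
    have h0 : HasFDerivAt (fun y : A => π (f (G y)))
        (π.comp ((fderiv ℂ f p).comp ((ContinuousLinearMap.id ℂ E).comp A.subtypeL))) 0 := by
      refine π.hasFDerivAt.comp _ (HasFDerivAt.comp (g := f) _ ?_ (HasFDerivAt.comp (g := G) _ ?_ A.subtypeL.hasFDerivAt))
      · simpa [hG0] using hfp
      · simpa using hG1
    have := ih (p := (0 : A)) (k := ⟨k, hkA⟩) hA hB isOpen_ball hd hi (mem_ball_self hr) (by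
      rw [h0.fderiv]
      simp [hk])
    exact hk0 (by simpa using congrArg (fun x : A => (x : E)) this)

/-- An injective holomorphic map between spaces of the same dimension is a biholomorphism onto
its open image. -/
theorem isOpen_image_and_differentiableOn_inverse {E : Type u} {F : Type v} [NormedAddCommGroup E]
    [NormedSpace ℂ E] [NormedAddCommGroup F] [NormedSpace ℂ F] [FiniteDimensional ℂ E]
    [FiniteDimensional ℂ F] (hdim : Module.finrank ℂ E = Module.finrank ℂ F)
    {f : E → F} {U : Set E} (hU : IsOpen U) (hf : DifferentiableOn ℂ f U) (hinj : InjOn f U) :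
    ∃ G : F → E, IsOpen (f '' U) ∧ DifferentiableOn ℂ G (f '' U) ∧ ∀ z ∈ U, G (f z) = z := by
  have hG : ∀ z ∈ U, Function.invFunOn f U (f z) = z := fun z hz => hinj.leftInvOn_invFunOn hz
  have key := fun p (hp : p ∈ U) => map_nhds_and_inverse_differentiableAt hU hf hG hp hdim
    (fun v hv => injective_fderiv_of_injOn _ rfl hdim.symm hU hf hinj hp hv)
  refine ⟨Function.invFunOn f U, ?_, ?_, hG⟩
  · rw [isOpen_iff_mem_nhds]
    rintro _ ⟨p, hp, rfl⟩
    rw [← (key p hp).1]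
    exact image_mem_map (hU.mem_nhds hp)
  · rintro _ ⟨p, hp, rfl⟩
    exact (key p hp).2.differentiableWithinAt

end OsgoodMain

section Shear

variable {n : ℕ}

theorem isShear_of_invariant {v : EuclideanSpace ℂ (Fin n)} {μ : EuclideanSpace ℂ (Fin n) →L[ℂ] ℂ}
    (hμ : μ v = 1) {f g : EuclideanSpace ℂ (Fin n) → ℂ} (hf : Differentiable ℂ f)
    (hg : Differentiable ℂ g) (hfv : ∀ z (c : ℂ), f (z + c • v) = f z)
    (hgv : ∀ z (c : ℂ), g (z + c • v) = g z) :
    IsShear fun z => z + ((Complex.exp (f z) - 1) * μ z + g z) • v := by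
  have hv : v ≠ 0 := by
    rintro rfl
    simp at hμ
  have hn : 0 < n := by
    rcases Nat.eq_zero_or_pos n with rfl | h
    · exact absurd (Subsingleton.elim v 0) hv
    · exact h
  let i : Fin n := ⟨n - 1, by omega⟩
  have he : (EuclideanSpace.single i (1 : ℂ)) ≠ 0 := by
    intro h
    have := congrArg (fun x : EuclideanSpace ℂ (Fin n) => x i) h
    simp at this
  obtain ⟨A, hA⟩ := SeparatingDual.exists_continuousLinearEquiv_apply_eq (R := ℂ) hv he
  have hAs : A.symm (EuclideanSpace.single i (1 : ℂ)) = v := by rw [← hA]; simp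
  have hshift : ∀ z w : EuclideanSpace ℂ (Fin n), (∀ j : Fin n, j ≠ i → z j = w j) →
      z = w + (z i - w i) • EuclideanSpace.single i (1 : ℂ) := by
    intro z w h
    ext j
    by_cases hj : j = i
    · subst hj; simp
    · simp [hj, h j hj]
  have hshift' : ∀ z w : EuclideanSpace ℂ (Fin n), (∀ j : Fin n, j ≠ i → z j = w j) →
      A.symm z = A.symm w + (z i - w i) • v := by
    intro z w h
    conv_lhs => rw [hshift z w h]
    rw [map_add, map_smul, hAs]
  have hproj : Differentiable ℂ fun y : EuclideanSpace ℂ (Fin n) => y i :=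
    (EuclideanSpace.proj (𝕜 := ℂ) i).differentiable
  have hAd : Differentiable ℂ fun y => A.symm y := A.symm.differentiable
  refine ⟨A, fun y => y + ((Complex.exp (f (A.symm y)) - 1) * μ (A.symm y) + g (A.symm y)) •
    EuclideanSpace.single i (1 : ℂ), ⟨i, fun y => f (A.symm y),
    fun y => (Complex.exp (f (A.symm y)) - 1) * (μ (A.symm y) - y i) + g (A.symm y), rfl,
    hf.comp hAd, ?_, ?_, ?_, ?_, ?_⟩, ?_⟩
  · exact (((hf.comp hAd).cexp.sub_const 1).mul ((μ.differentiable.comp hAd).sub hproj)).add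
      (hg.comp hAd)
  · intro z w h
    simp only [hshift' z w h, hfv]
  · intro z w h
    simp only [hshift' z w h, hfv, hgv, map_add, map_smul, hμ, smul_eq_mul]
    ring
  · intro z
    simp
    ring
  · intro z j hj
    simp [hj]
  · funext z
    simp [hAs]

theorem isShearComposition_of_isShear {ψ : EuclideanSpace ℂ (Fin n) → EuclideanSpace ℂ (Fin n)}
    (h : IsShear ψ) : IsShearComposition ψ :=
  ⟨[ψ], by simp, by simpa using h, by simp⟩

theorem IsShearComposition.comp {ψ φ : EuclideanSpace ℂ (Fin n) → EuclideanSpace ℂ (Fin n)}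
    (hψ : IsShearComposition ψ) (hφ : IsShearComposition φ) : IsShearComposition (ψ ∘ φ) := by
  obtain ⟨L, hL, hLs, rfl⟩ := hψ
  obtain ⟨M, -, hMs, rfl⟩ := hφ
  refine ⟨L ++ M, by simp [hL], ?_, ?_⟩
  · intro φ hφ
    rcases List.mem_append.1 hφ with h | h
    · exact hLs φ h
    · exact hMs φ h
  · clear hL hLs
    induction L with
    | nil => simp
    | cons a L ih =>
      simp only [List.cons_append, List.foldr_cons, ← ih]
      rfl

theorem isShearComposition_id (hn : 0 < n) :
    IsShearComposition (id : EuclideanSpace ℂ (Fin n) → EuclideanSpace ℂ (Fin n)) := by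
  refine isShearComposition_of_isShear ?_
  let i : Fin n := ⟨0, hn⟩
  have := isShear_of_invariant (v := EuclideanSpace.single i (1 : ℂ))
    (μ := EuclideanSpace.proj (𝕜 := ℂ) i) (by simp) (f := fun _ => 0) (g := fun _ => 0)
    (differentiable_const _) (differentiable_const _) (fun _ _ => rfl) (fun _ _ => rfl)
  convert this using 1
  funext z
  simp

/-- A continuous vector field `X` such that `z ↦ z + h X(z)` is approximated to first order in
`h > 0`, locally uniformly, by compositions of shears. -/
def IsShearField (X : EuclideanSpace ℂ (Fin n) → EuclideanSpace ℂ (Fin n)) : Prop :=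
  Continuous X ∧ ∀ R ε : ℝ, 0 < ε → ∃ δ > 0, ∀ h : ℝ, 0 < h → h < δ → ∃ ψ, IsShearComposition ψ ∧
    ∀ z, ‖z‖ ≤ R → ‖ψ z - z - (h : ℂ) • X z‖ ≤ ε * h

theorem exists_norm_le_of_continuous {F : Type*} [NormedAddCommGroup F]
    {X : EuclideanSpace ℂ (Fin n) → F} (hX : Continuous X) (R : ℝ) :
    ∃ C > 0, ∀ z, ‖z‖ ≤ R → ‖X z‖ ≤ C := by
  obtain ⟨C, hC⟩ := (isCompact_closedBall (0 : EuclideanSpace ℂ (Fin n)) R).exists_bound_of_continuousOn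
    hX.continuousOn
  exact ⟨max C 1, by positivity, fun z hz => (hC z (by simpa using hz)).trans (le_max_left _ _)⟩

theorem isShearField_zero (hn : 0 < n) :
    IsShearField (fun _ => 0 : EuclideanSpace ℂ (Fin n) → EuclideanSpace ℂ (Fin n)) := by
  refine ⟨continuous_const, fun R ε hε => ⟨1, one_pos, fun h hh _ => ⟨id, isShearComposition_id hn,
    fun z _ => ?_⟩⟩⟩
  simp
  positivity

theorem IsShearField.add {X Y : EuclideanSpace ℂ (Fin n) → EuclideanSpace ℂ (Fin n)}
    (hX : IsShearField X) (hY : IsShearField Y) : IsShearField (fun z => X z + Y z) := by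
  refine ⟨hX.1.add hY.1, fun R ε hε => ?_⟩
  obtain ⟨C, hC, hCX⟩ := exists_norm_le_of_continuous hX.1 R
  have huc := (isCompact_closedBall (0 : EuclideanSpace ℂ (Fin n)) (R + 1)).uniformContinuousOn_of_continuous
    hY.1.continuousOn
  obtain ⟨η, hη, hYη⟩ := Metric.uniformContinuousOn_iff.1 huc (ε / 3) (by positivity)
  obtain ⟨δ₁, hδ₁, h₁⟩ := hX.2 R (ε / 3) (by positivity)
  obtain ⟨δ₂, hδ₂, h₂⟩ := hY.2 (R + 1) (ε / 3) (by positivity)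
  refine ⟨min (min δ₁ δ₂) (min (η / (C + ε)) (1 / (C + ε))), by positivity, fun h hh hlt => ?_⟩
  simp only [lt_min_iff] at hlt
  obtain ⟨⟨hlt1, hlt2⟩, hlt3, hlt4⟩ := hlt
  rw [lt_div_iff₀ (by positivity)] at hlt3 hlt4
  obtain ⟨ψ, hψ, hψX⟩ := h₁ h hh hlt1
  obtain ⟨φ, hφ, hφY⟩ := h₂ h hh hlt2
  refine ⟨φ ∘ ψ, hφ.comp hψ, fun z hz => ?_⟩
  have e1 := hψX z hz
  have e2 : ‖ψ z - z‖ ≤ h * (C + ε / 3) := by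
    calc ‖ψ z - z‖ = ‖(ψ z - z - (h : ℂ) • X z) + (h : ℂ) • X z‖ := by congr 1; abel
      _ ≤ ε / 3 * h + h * C := by
        refine (norm_add_le _ _).trans (add_le_add e1 ?_)
        rw [norm_smul, Complex.norm_real, Real.norm_of_nonneg hh.le]
        exact mul_le_mul_of_nonneg_left (hCX z hz) hh.le
      _ = _ := by ring
  have e3 : ‖ψ z‖ ≤ R + 1 := by
    have : ‖ψ z‖ ≤ ‖z‖ + ‖ψ z - z‖ := by
      simpa using norm_add_le z (ψ z - z)
    nlinarith
  have e4 := hφY (ψ z) e3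
  have e5 : ‖Y (ψ z) - Y z‖ ≤ ε / 3 := by
    rw [← dist_eq_norm]
    refine (hYη _ (by simpa using e3) z (by simpa using hz.trans (by linarith)) ?_).le
    rw [dist_eq_norm]
    nlinarith
  calc ‖(φ ∘ ψ) z - z - (h : ℂ) • (X z + Y z)‖
      = ‖(φ (ψ z) - ψ z - (h : ℂ) • Y (ψ z)) + (ψ z - z - (h : ℂ) • X z) +
          (h : ℂ) • (Y (ψ z) - Y z)‖ := by
        congr 1; simp only [Function.comp, smul_add, smul_sub]; abel
    _ ≤ ε / 3 * h + ε / 3 * h + h * (ε / 3) := by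
        refine (norm_add₃_le).trans (add_le_add (add_le_add e4 e1) ?_)
        rw [norm_smul, Complex.norm_real, Real.norm_of_nonneg hh.le]
        exact mul_le_mul_of_nonneg_left e5 hh.le
    _ = ε * h := by ring

theorem IsShearField.sum (hn : 0 < n) {ι : Type*} (s : Finset ι)
    {X : ι → EuclideanSpace ℂ (Fin n) → EuclideanSpace ℂ (Fin n)}
    (hX : ∀ i, IsShearField (X i)) : IsShearField (fun z => ∑ i ∈ s, X i z) := by
  classical
  induction s using Finset.induction_on with
  | empty => simpa using isShearField_zero hn
  | insert a s ha ih => simpa [Finset.sum_insert ha] using (hX a).add ih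

theorem isShearField_of_approx {X : EuclideanSpace ℂ (Fin n) → EuclideanSpace ℂ (Fin n)}
    (hX : Continuous X)
    (h : ∀ R ε : ℝ, 0 < ε → ∃ Y, IsShearField Y ∧ ∀ z, ‖z‖ ≤ R → ‖Y z - X z‖ ≤ ε) :
    IsShearField X := by
  refine ⟨hX, fun R ε hε => ?_⟩
  obtain ⟨Y, hY, hYX⟩ := h R (ε / 2) (by positivity)
  obtain ⟨δ, hδ, hδY⟩ := hY.2 R (ε / 2) (by positivity)
  refine ⟨δ, hδ, fun s hs hsδ => ?_⟩
  obtain ⟨ψ, hψ, hψY⟩ := hδY s hs hsδ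
  refine ⟨ψ, hψ, fun z hz => ?_⟩
  calc ‖ψ z - z - (s : ℂ) • X z‖
      = ‖(ψ z - z - (s : ℂ) • Y z) + (s : ℂ) • (Y z - X z)‖ := by
        congr 1; simp only [smul_sub]; abel
    _ ≤ ε / 2 * s + s * (ε / 2) := by
        refine (norm_add_le _ _).trans (add_le_add (hψY z hz) ?_)
        rw [norm_smul, Complex.norm_real, Real.norm_of_nonneg hs.le]
        exact mul_le_mul_of_nonneg_left (hYX z hz) hs.le
    _ = ε * s := by ring

theorem isShearField_of_invariant {v : EuclideanSpace ℂ (Fin n)}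
    {μ : EuclideanSpace ℂ (Fin n) →L[ℂ] ℂ}
    (hμ : μ v = 1) {f g : EuclideanSpace ℂ (Fin n) → ℂ} (hf : Differentiable ℂ f)
    (hg : Differentiable ℂ g) (hfv : ∀ z (c : ℂ), f (z + c • v) = f z)
    (hgv : ∀ z (c : ℂ), g (z + c • v) = g z) :
    IsShearField fun z => (f z * μ z + g z) • v := by
  refine ⟨((hf.continuous.mul μ.continuous).add hg.continuous).smul continuous_const,
    fun R ε hε => ?_⟩
  obtain ⟨C, hC, hCf⟩ := exists_norm_le_of_continuous hf.continuous R
  obtain ⟨D, hD, hDμ⟩ := exists_norm_le_of_continuous (μ.continuous.smul (continuous_const (y := v))) R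
  refine ⟨min (1 / C) (ε / (C ^ 2 * D)), by positivity, fun h hh hlt => ?_⟩
  obtain ⟨hlt1, hlt2⟩ := lt_min_iff.1 hlt
  rw [lt_div_iff₀ (by positivity)] at hlt1 hlt2
  refine ⟨_, isShearComposition_of_isShear (isShear_of_invariant hμ (hf.const_mul (h : ℂ))
    (hg.const_mul (h : ℂ)) (fun z c => by simp only [hfv]) (fun z c => by simp only [hgv])),
    fun z hz => ?_⟩
  have e1 : ‖(h : ℂ) * f z‖ ≤ h * C := by
    rw [norm_mul, Complex.norm_real, Real.norm_of_nonneg hh.le]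
    exact mul_le_mul_of_nonneg_left (hCf z hz) hh.le
  have e2 := Complex.norm_exp_sub_one_sub_id_le (e1.trans hlt1.le)
  calc _ = ‖(Complex.exp ((h : ℂ) * f z) - 1 - (h : ℂ) * f z) • (μ z • v)‖ := by
        congr 1; module
    _ ≤ (h * C) ^ 2 * D := by
        rw [norm_smul]
        refine mul_le_mul (e2.trans ?_) (hDμ z hz) (norm_nonneg _) (by positivity)
        exact pow_le_pow_left₀ (norm_nonneg _) e1 2
    _ = h * (h * (C ^ 2 * D)) := by ring
    _ ≤ h * ε := mul_le_mul_of_nonneg_left hlt2.le hh.le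
    _ = ε * h := mul_comm _ _

theorem isShearField_of_invariant' (hn : 0 < n) (v : EuclideanSpace ℂ (Fin n))
    {g : EuclideanSpace ℂ (Fin n) → ℂ} (hg : Differentiable ℂ g)
    (hgv : ∀ z (c : ℂ), g (z + c • v) = g z) : IsShearField fun z => g z • v := by
  by_cases hv : v = 0
  · subst hv
    simpa using isShearField_zero hn
  obtain ⟨μ, hμ⟩ := SeparatingDual.exists_eq_one (R := ℂ) hv
  simpa using isShearField_of_invariant hμ (differentiable_const 0) hg (fun _ _ => rfl) hgv

theorem exists_difference_quotient_exp (ζ η : EuclideanSpace ℂ (Fin n) →L[ℂ] ℂ) (R : ℝ) {ε : ℝ}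
    (hε : 0 < ε) : ∃ t : ℂ, t ≠ 0 ∧ ‖t‖ ≤ ε ∧ ∀ z, ‖z‖ ≤ R →
      ‖t⁻¹ * (Complex.exp (ζ z + t * η z) - Complex.exp (ζ z)) - Complex.exp (ζ z) * η z‖ ≤ ε := by
  obtain ⟨A, hA, hAz⟩ := exists_norm_le_of_continuous (ζ.continuous.cexp) R
  obtain ⟨B, hB, hBη⟩ := exists_norm_le_of_continuous η.continuous R
  set s : ℝ := min ε (min (1 / B) (ε / (A * B ^ 2))) with hs
  have hs0 : 0 < s := by positivity
  have hs1 : s * B ≤ 1 := by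
    rw [← le_div_iff₀ hB]
    exact (min_le_right _ _).trans (min_le_left _ _)
  have hs2 : s * (A * B ^ 2) ≤ ε := by
    rw [← le_div_iff₀ (by positivity)]
    exact (min_le_right _ _).trans (min_le_right _ _)
  have hsn : ‖(s : ℂ)‖ = s := by rw [Complex.norm_real, Real.norm_of_nonneg hs0.le]
  have hsc : (s : ℂ) ≠ 0 := by exact_mod_cast hs0.ne'
  refine ⟨s, hsc, by rw [hsn]; exact min_le_left _ _, fun z hz => ?_⟩
  have e1 : ‖(s : ℂ) * η z‖ ≤ s * B := by
    rw [norm_mul, hsn]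
    exact mul_le_mul_of_nonneg_left (hBη z hz) hs0.le
  have e2 := Complex.norm_exp_sub_one_sub_id_le (e1.trans hs1)
  calc _ = ‖(s : ℂ)⁻¹ * Complex.exp (ζ z) * (Complex.exp (s * η z) - 1 - s * η z)‖ := by
        congr 1
        rw [Complex.exp_add]
        field_simp
    _ ≤ s⁻¹ * A * (s * B) ^ 2 := by
        rw [norm_mul, norm_mul, norm_inv, hsn]
        gcongr
        · exact hAz z hz
        · exact e2.trans (pow_le_pow_left₀ (norm_nonneg _) e1 2)
    _ = s * (A * B ^ 2) := by field_simp
    _ ≤ ε := hs2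

theorem isShearField_exp_of_ker (hn : 0 < n) (ζ : EuclideanSpace ℂ (Fin n) →L[ℂ] ℂ)
    {w : EuclideanSpace ℂ (Fin n)} (h : ζ w = 0) :
    IsShearField fun z => Complex.exp (ζ z) • w :=
  isShearField_of_invariant' hn w ζ.differentiable.cexp fun z c => by simp [h]

theorem isShearField_exp (hn : 2 ≤ n) (ζ : EuclideanSpace ℂ (Fin n) →L[ℂ] ℂ)
    (w : EuclideanSpace ℂ (Fin n)) : IsShearField fun z => Complex.exp (ζ z) • w := by
  have hn0 : 0 < n := by omega
  by_cases hw : ζ w = 0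
  · exact isShearField_exp_of_ker hn0 ζ hw
  obtain ⟨v, hv, hζv⟩ : ∃ v, v ≠ 0 ∧ ζ v = 0 := by
    by_contra! hcon
    have hli : Function.Injective (ζ : EuclideanSpace ℂ (Fin n) →ₗ[ℂ] ℂ) := by
      refine (injective_iff_map_eq_zero _).2 fun w hw => ?_
      by_contra hw0
      exact hcon w hw0 hw
    have := LinearMap.finrank_le_finrank_of_injective hli
    simp at this
    omega
  obtain ⟨η₀, hη₀⟩ := SeparatingDual.exists_eq_one (R := ℂ) hv
  set η := η₀ - (η₀ w / ζ w) • ζ with hη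
  have hηv : η v = 1 := by simp [hη, hη₀, hζv]
  have hηw : η w = 0 := by simp [hη, hw]
  set ξ := -(ζ w) • η with hξ
  have hξv : ξ v = -ζ w := by simp [hξ, hηv]
  have hξw : ξ w = 0 := by simp [hξ, hηw]
  have hmain : IsShearField fun z => (Complex.exp (ζ z) * ξ z) • v + Complex.exp (ζ z) • w := by
    refine isShearField_of_approx (by fun_prop) fun R ε hε => ?_
    obtain ⟨A, hA, hAz⟩ := exists_norm_le_of_continuous (X := fun z => Complex.exp (ζ z) * ξ z)
      (by fun_prop) R
    set ε' := min 1 (ε / (‖v‖ + (1 + A) * ‖w‖ + 1)) with hε'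
    have hε'0 : 0 < ε' := by positivity
    have hε'1 : ε' ≤ 1 := min_le_left _ _
    have hε'2 : ε' * (‖v‖ + (1 + A) * ‖w‖ + 1) ≤ ε := by
      rw [← le_div_iff₀ (by positivity)]; exact min_le_right _ _
    obtain ⟨t, ht0, htε, ht⟩ := exists_difference_quotient_exp ζ ξ R hε'0
    have h1 := isShearField_exp_of_ker hn0 (ζ + t • ξ) (w := t⁻¹ • (v + t • w)) (by
      simp [hζv, hξw, hξv]; ring)
    have h2 := isShearField_exp_of_ker hn0 ζ (w := -(t⁻¹ • v)) (by simp [hζv])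
    refine ⟨_, h1.add h2, fun z hz => ?_⟩
    have h3 := ht z hz
    have h4 := hAz z hz
    set D := t⁻¹ * (Complex.exp (ζ z + t * ξ z) - Complex.exp (ζ z)) with hD
    have h5 : ‖D‖ ≤ 1 + A := by
      calc ‖D‖ = ‖(D - Complex.exp (ζ z) * ξ z) + Complex.exp (ζ z) * ξ z‖ := by congr 1; ring
        _ ≤ ε' + A := (norm_add_le _ _).trans (add_le_add h3 h4)
        _ ≤ 1 + A := by linarith
    have h6 : Complex.exp (ζ z + t * ξ z) = Complex.exp (ζ z) + t * D := by
      rw [hD]; field_simp; ring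
    calc _ = ‖(D - Complex.exp (ζ z) * ξ z) • v + (t * D) • w‖ := by
          congr 1
          simp only [add_apply, smul_apply, smul_eq_mul, h6]
          match_scalars <;> (field_simp; try ring)
      _ ≤ ε' * ‖v‖ + (ε' * (1 + A)) * ‖w‖ := by
          refine (norm_add_le _ _).trans (add_le_add ?_ ?_)
          · rw [norm_smul]; gcongr
          · rw [norm_smul, norm_mul]; gcongr
      _ ≤ ε := by nlinarith
  have hcorr : IsShearField fun z => (-(Complex.exp (ζ z) * ξ z)) • v := by
    have h1 := isShearField_of_invariant (v := v) (μ := η) hηv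
      (f := fun z => Complex.exp (ζ z) * ζ w) (g := fun _ => 0) (by fun_prop) (by fun_prop)
      (fun z c => by simp [hζv]) (fun _ _ => rfl)
    convert h1 using 3 with z
    simp [hξ]
    ring
  convert hmain.add hcorr using 2 with z
  module

theorem isShearField_polynomial_exp (hn : 2 ≤ n) (P : MvPolynomial (Fin n) ℂ) :
    ∀ (ζ : EuclideanSpace ℂ (Fin n) →L[ℂ] ℂ) (w : EuclideanSpace ℂ (Fin n)),
      IsShearField fun z => (MvPolynomial.eval (fun i => z i) P * Complex.exp (ζ z)) • w := by
  have hcont : ∀ P : MvPolynomial (Fin n) ℂ, Continuous fun z : EuclideanSpace ℂ (Fin n) =>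
      MvPolynomial.eval (fun i => z i) P := fun P =>
    (MvPolynomial.continuous_eval P).comp (by fun_prop)
  induction P using MvPolynomial.induction_on with
  | C a =>
    intro ζ w
    convert isShearField_exp hn ζ (a • w) using 2 with z
    simp [smul_smul, mul_comm]
  | add P Q hP hQ =>
    intro ζ w
    convert (hP ζ w).add (hQ ζ w) using 2 with z
    simp only [map_add]
    module
  | mul_X P i hP =>
    intro ζ w
    refine isShearField_of_approx (by
      have := hcont (P * MvPolynomial.X i)
      fun_prop) fun R ε hε => ?_
    obtain ⟨A, hA, hAz⟩ := exists_norm_le_of_continuous (hcont P) R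
    obtain ⟨t, ht0, -, ht⟩ := exists_difference_quotient_exp ζ (EuclideanSpace.proj (𝕜 := ℂ) i) R
      (ε := ε / (A * (‖w‖ + 1))) (by positivity)
    refine ⟨_, (hP (ζ + t • EuclideanSpace.proj (𝕜 := ℂ) i) (t⁻¹ • w)).add (hP ζ (-(t⁻¹ • w))),
      fun z hz => ?_⟩
    have h3 := ht z hz
    have h4 := hAz z hz
    calc _ = ‖(MvPolynomial.eval (fun i => z i) P * (t⁻¹ * (Complex.exp (ζ z + t * z i)
            - Complex.exp (ζ z)) - Complex.exp (ζ z) * z i)) • w‖ := by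
          congr 1
          simp only [add_apply, smul_apply, smul_eq_mul,
            map_mul, MvPolynomial.eval_X,
            show EuclideanSpace.proj (𝕜 := ℂ) i z = z i from rfl]
          module
      _ ≤ A * (ε / (A * (‖w‖ + 1))) * (‖w‖ + 1) := by
          rw [norm_smul, norm_mul]
          gcongr
          · exact h3
          · linarith
      _ = ε := by field_simp

/-- A self-map of `ℂⁿ` with polynomial components. -/
def IsPolynomialMap (X : EuclideanSpace ℂ (Fin n) → EuclideanSpace ℂ (Fin n)) : Prop :=
  ∃ p : Fin n → MvPolynomial (Fin n) ℂ, ∀ z i, X z i = MvPolynomial.eval (fun j => z j) (p i)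

/-- Polynomial vector fields are, to first order, limits of compositions of shears
(Andersén–Lempert). -/
theorem IsPolynomialMap.isShearField (hn : 2 ≤ n)
    {X : EuclideanSpace ℂ (Fin n) → EuclideanSpace ℂ (Fin n)} (hX : IsPolynomialMap X) :
    IsShearField X := by
  obtain ⟨p, hp⟩ := hX
  have := IsShearField.sum (by omega) Finset.univ fun i =>
    isShearField_polynomial_exp hn (p i) 0 (EuclideanSpace.single i (1 : ℂ))
  convert this using 1
  funext z
  ext j
  simp [hp, Finset.sum_apply, Pi.single_apply]

end Shear

section PolynomialMap

variable {n : ℕ}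

theorem isPolynomialMap_id : IsPolynomialMap (fun z : EuclideanSpace ℂ (Fin n) => z) :=
  ⟨fun i => MvPolynomial.X i, fun z i => by simp⟩

theorem IsPolynomialMap.sub {X Y : EuclideanSpace ℂ (Fin n) → EuclideanSpace ℂ (Fin n)}
    (hX : IsPolynomialMap X) (hY : IsPolynomialMap Y) : IsPolynomialMap fun z => X z - Y z := by
  obtain ⟨p, hp⟩ := hX
  obtain ⟨q, hq⟩ := hY
  exact ⟨fun i => p i - q i, fun z i => by simp [hp, hq]⟩

theorem IsPolynomialMap.comp {X Y : EuclideanSpace ℂ (Fin n) → EuclideanSpace ℂ (Fin n)}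
    (hX : IsPolynomialMap X) (hY : IsPolynomialMap Y) : IsPolynomialMap fun z => X (Y z) := by
  obtain ⟨p, hp⟩ := hX
  obtain ⟨q, hq⟩ := hY
  refine ⟨fun i => MvPolynomial.bind₁ q (p i), fun z i => ?_⟩
  rw [hp, ← MvPolynomial.coe_aeval_eq_eval, ← MvPolynomial.coe_aeval_eq_eval]
  simp only [RingHom.coe_coe, MvPolynomial.aeval_bind₁]
  congr 2
  funext j
  rw [hq, ← MvPolynomial.coe_aeval_eq_eval]
  rfl

theorem IsPolynomialMap.differentiable
    {X : EuclideanSpace ℂ (Fin n) → EuclideanSpace ℂ (Fin n)}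
    (hX : IsPolynomialMap X) : Differentiable ℂ X := by
  obtain ⟨p, hp⟩ := hX
  rw [differentiable_euclidean]
  intro i
  simp only [hp]
  induction p i using MvPolynomial.induction_on with
  | C a => simp
  | add P Q hP hQ =>
    simp only [map_add]
    exact hP.add hQ
  | mul_X P j hP =>
    simp only [map_mul, MvPolynomial.eval_X]
    exact hP.mul (EuclideanSpace.proj (𝕜 := ℂ) j).differentiable

theorem norm_le_sum_norm_coord (x : EuclideanSpace ℂ (Fin n)) : ‖x‖ ≤ ∑ i, ‖x i‖ := by
  have h : x = ∑ i, x i • EuclideanSpace.single i (1 : ℂ) := by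
    ext j
    simp [Finset.sum_apply, Pi.single_apply]
  calc ‖x‖ = ‖∑ i, x i • EuclideanSpace.single i (1 : ℂ)‖ := by rw [← h]
    _ ≤ ∑ i, ‖x i • EuclideanSpace.single i (1 : ℂ)‖ := norm_sum_le _ _
    _ = ∑ i, ‖x i‖ := by simp [norm_smul]

theorem IsRunge.exists_polynomialMap {Ω : Set (EuclideanSpace ℂ (Fin n))} (hΩ : IsRunge Ω)
    {g : EuclideanSpace ℂ (Fin n) → EuclideanSpace ℂ (Fin n)} (hg : DifferentiableOn ℂ g Ω)
    {N : Set (EuclideanSpace ℂ (Fin n))} (hNΩ : N ⊆ Ω) (hN : IsCompact N) {ε : ℝ} (hε : 0 < ε) :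
    ∃ P, IsPolynomialMap P ∧ ∀ z ∈ N, ‖P z - g z‖ ≤ ε := by
  have h := fun i => hΩ (fun z => g z i)
    ((EuclideanSpace.proj (𝕜 := ℂ) i).differentiable.comp_differentiableOn hg) N hNΩ hN
    (ε / (n + 1)) (by positivity)
  choose p hp using h
  refine ⟨fun z => WithLp.toLp 2 fun i => MvPolynomial.eval (fun j => z j) (p i),
    ⟨p, fun z i => rfl⟩, fun z hz => ?_⟩
  refine (norm_le_sum_norm_coord _).trans ?_
  calc _ ≤ ∑ i : Fin n, ε / (n + 1) := by
        refine Finset.sum_le_sum fun i _ => ?_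
        have := (hp i z hz).le
        rw [norm_sub_rev] at this
        exact this
    _ = n * (ε / (n + 1)) := by simp
    _ ≤ ε := by
        rw [← mul_div_assoc, div_le_iff₀ (by positivity)]
        nlinarith

/-- If `U` is small, the vector field `y + U y ↦ g y` can be approximated by polynomial maps,
with a Lipschitz constant that does not depend on the quality of the approximation. -/
theorem IsRunge.exists_polynomialMap_perturbation {Ω N Y : Set (EuclideanSpace ℂ (Fin n))}
    (hΩ : IsRunge Ω) (hNΩ : N ⊆ Ω) (hN : IsCompact N) {r M : ℝ} (hr : 0 < r) (hM : 0 ≤ M)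
    (hY : ∀ y ∈ Y, closedBall y r ⊆ N)
    {U g : EuclideanSpace ℂ (Fin n) → EuclideanSpace ℂ (Fin n)}
    (hU : DifferentiableOn ℂ U Ω) (hg : DifferentiableOn ℂ g Ω)
    (hUr : ∀ z ∈ N, ‖U z‖ ≤ r / 64) (hgM : ∀ z ∈ N, ‖g z‖ ≤ M) {ε : ℝ} (hε : 0 < ε) :
    ∃ P, IsPolynomialMap P ∧ ∀ y ∈ Y, ∀ w, ‖w - (y + U y)‖ ≤ r / 64 →
      ‖P w - g y‖ ≤ 8 * (M + 1) / r * ‖w - (y + U y)‖ + ε := by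
  set L := 8 * (M + 1) / r with hL
  have hL0 : 0 < L := by positivity
  set τ : ℝ := min (min 1 (r / 64)) (ε / 2 / (L + 1)) with hτ
  have hτ0 : 0 < τ := by positivity
  have hτ1 : τ ≤ 1 := (min_le_left _ _).trans (min_le_left _ _)
  have hτr : τ ≤ r / 64 := (min_le_left _ _).trans (min_le_right _ _)
  have hτε : τ * (L + 1) ≤ ε / 2 := by
    rw [← le_div_iff₀ (by positivity)]; exact min_le_right _ _
  obtain ⟨k, hk⟩ := exists_pow_lt_of_lt_one (show 0 < ε / 2 / (M + 1) by positivity)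
    (show (1 / 2 : ℝ) < 1 by norm_num)
  rw [lt_div_iff₀ (by positivity)] at hk
  obtain ⟨P₀, hP₀, hP₀U⟩ := hΩ.exists_polynomialMap hU hNΩ hN hτ0
  obtain ⟨q, hq, hqg⟩ := hΩ.exists_polynomialMap hg hNΩ hN hτ0
  have hP₀N : ∀ z ∈ N, ‖P₀ z‖ ≤ r / 32 := fun z hz => by
    have := norm_add_le (P₀ z - U z) (U z)
    rw [sub_add_cancel] at this
    linarith [hP₀U z hz, hUr z hz]
  have hqN : ∀ z ∈ N, ‖q z‖ ≤ M + 1 := fun z hz => by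
    have := norm_add_le (q z - g z) (g z)
    rw [sub_add_cancel] at this
    linarith [hqg z hz, hgM z hz]
  let Q : ℕ → EuclideanSpace ℂ (Fin n) → EuclideanSpace ℂ (Fin n) := fun j =>
    Nat.rec (fun w => w) (fun _ R w => w - P₀ (R w)) j
  have hQ : ∀ j, IsPolynomialMap (Q j) := by
    intro j
    induction j with
    | zero => exact isPolynomialMap_id
    | succ j ih => exact isPolynomialMap_id.sub (hP₀.comp ih)
  refine ⟨fun w => q (Q k w), hq.comp (hQ k), fun y hy w hw => ?_⟩
  have hballN : ball y r ⊆ N := ball_subset_closedBall.trans (hY y hy)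
  have hyN : y ∈ N := hballN (mem_ball_self hr)
  have hy4 : y ∈ ball y (r / 4) := mem_ball_self (by positivity)
  set d := ‖w - (y + U y)‖ with hd
  have hd0 : 0 ≤ d := norm_nonneg _
  have hTy : ‖w - P₀ y - y‖ ≤ d + τ := by
    calc ‖w - P₀ y - y‖ = ‖(w - (y + U y)) - (P₀ y - U y)‖ := by congr 1; abel
      _ ≤ d + τ := (norm_sub_le _ _).trans (add_le_add le_rfl (hP₀U y hyN))
  have hiter : ∀ j, ‖Q j w - y‖ ≤ 2 * (d + τ) + (1 / 2) ^ j * (r / 32) := by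
    intro j
    induction j with
    | zero =>
      have h1 : ‖w - y‖ ≤ d + r / 64 := by
        calc ‖w - y‖ = ‖(w - (y + U y)) + U y‖ := by congr 1; abel
          _ ≤ d + r / 64 := (norm_add_le _ _).trans (add_le_add le_rfl (hUr y hyN))
      show ‖w - y‖ ≤ _
      rw [pow_zero, one_mul]
      linarith
    | succ j ih =>
      have hpow : (1 / 2 : ℝ) ^ j ≤ 1 := pow_le_one₀ (by norm_num) (by norm_num)
      have hmem : Q j w ∈ ball y (r / 4) := by
        rw [mem_ball, dist_eq_norm]
        nlinarith
      have hlip := norm_sub_le_of_norm_le_on_ball hr hP₀.differentiable.differentiableOn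
        (fun z hz => hP₀N z (hballN hz)) hmem hy4
      have h8 : 4 * (r / 32) / r = 1 / 8 := by field_simp; norm_num
      rw [h8] at hlip
      have hstep : ‖Q (j + 1) w - y‖ ≤ (d + τ) + 1 / 8 * ‖Q j w - y‖ := by
        calc ‖Q (j + 1) w - y‖ = ‖(w - P₀ y - y) - (P₀ (Q j w) - P₀ y)‖ := by
              congr 1
              show w - P₀ (Q j w) - y = _
              abel
          _ ≤ _ := (norm_sub_le _ _).trans (add_le_add hTy hlip)
      rw [pow_succ]
      linarith [norm_nonneg (Q j w - y)]
  have hpow : (1 / 2 : ℝ) ^ k ≤ 1 := pow_le_one₀ (by norm_num) (by norm_num)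
  have hmem : Q k w ∈ ball y (r / 4) := by
    rw [mem_ball, dist_eq_norm]
    have := hiter k
    nlinarith
  have hlip := norm_sub_le_of_norm_le_on_ball hr hq.differentiable.differentiableOn
    (fun z hz => hqN z (hballN hz)) hmem hy4
  have hL4 : 4 * (M + 1) / r = L / 2 := by rw [hL]; ring
  rw [hL4] at hlip
  have hLr : L * r = 8 * (M + 1) := by rw [hL]; field_simp
  calc ‖q (Q k w) - g y‖ = ‖(q (Q k w) - q y) + (q y - g y)‖ := by congr 1; abel
    _ ≤ L / 2 * (2 * (d + τ) + (1 / 2) ^ k * (r / 32)) + τ := by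
        refine (norm_add_le _ _).trans (add_le_add (hlip.trans ?_) (hqg y hyN))
        gcongr
        exact hiter k
    _ = L * d + τ * (L + 1) + (1 / 2) ^ k * (L * r) / 64 := by ring
    _ ≤ L * d + ε := by
        rw [hLr]
        have : 0 ≤ (1 / 2 : ℝ) ^ k * (M + 1) := by positivity
        linarith

end PolynomialMap

section Gronwall

theorem eq_zero_of_liminf_slope_le {f : ℝ → ℝ} {L : ℝ} (hf : ContinuousOn f (Icc 0 1))
    (h0 : f 0 ≤ 0)
    (h : ∀ s ∈ Icc (0 : ℝ) 1, ∀ ε > 0, ∃ δ > 0, ∀ t, 0 < t → t < δ →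
      f (s + t) ≤ f s + t * (L * f s + ε)) : f 1 ≤ 0 := by
  have key := le_gronwallBound_of_liminf_deriv_right_le (f := f) (f' := fun s => L * f s)
    (δ := 0) (K := L) (ε := 0) (a := 0) (b := 1) hf ?_ h0 (fun s _ => by simp) 1
    (by simp)
  · rwa [gronwallBound_ε0_δ0] at key
  intro s hs r hr
  obtain ⟨δ, hδ, hδs⟩ := h s (Ico_subset_Icc_self hs) ((r - L * f s) / 2) (by linarith)
  refine Eventually.frequently ?_
  filter_upwards [Ioo_mem_nhdsGT (show s < s + δ by linarith)] with z hz
  have h1 := hδs (z - s) (by linarith [hz.1]) (by linarith [hz.2])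
  have hpos : 0 < z - s := by linarith [hz.1]
  rw [add_sub_cancel] at h1
  rw [inv_mul_lt_iff₀ hpos]
  nlinarith

end Gronwall

section Isotopy

variable {n : ℕ}

/-- `A` is a uniform limit on `K` of compositions of shears. -/
def IsShearApproximable (A : EuclideanSpace ℂ (Fin n) → EuclideanSpace ℂ (Fin n))
    (K : Set (EuclideanSpace ℂ (Fin n))) : Prop :=
  ∀ ε : ℝ, 0 < ε → ∃ ψ, IsShearComposition ψ ∧ ∀ z ∈ K, ‖ψ z - A z‖ ≤ ε

/-- The uniform distance on `K` from `A` to the compositions of shears. -/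
def shearDist (A : EuclideanSpace ℂ (Fin n) → EuclideanSpace ℂ (Fin n))
    (K : Set (EuclideanSpace ℂ (Fin n))) : ℝ :=
  sInf {e | 0 ≤ e ∧ ∃ ψ, IsShearComposition ψ ∧ ∀ z ∈ K, ‖ψ z - A z‖ ≤ e}

variable {A B : EuclideanSpace ℂ (Fin n) → EuclideanSpace ℂ (Fin n)}
  {K : Set (EuclideanSpace ℂ (Fin n))}

theorem shearDist_le {e : ℝ} (he : 0 ≤ e) {ψ : EuclideanSpace ℂ (Fin n) → EuclideanSpace ℂ (Fin n)}
    (hψ : IsShearComposition ψ) (h : ∀ z ∈ K, ‖ψ z - A z‖ ≤ e) : shearDist A K ≤ e :=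
  csInf_le ⟨0, fun _ hx => hx.1⟩ ⟨he, ψ, hψ, h⟩

theorem shearDist_nonneg : 0 ≤ shearDist A K :=
  Real.sInf_nonneg fun _ hx => hx.1

theorem exists_of_shearDist_lt (hn : 0 < n) (hK : IsCompact K) (hA : ContinuousOn A K) {e : ℝ}
    (he : shearDist A K < e) :
    ∃ ψ, IsShearComposition ψ ∧ ∀ z ∈ K, ‖ψ z - A z‖ ≤ e := by
  have hne : {e | 0 ≤ e ∧ ∃ ψ, IsShearComposition ψ ∧ ∀ z ∈ K, ‖ψ z - A z‖ ≤ e}.Nonempty := by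
    obtain ⟨C, hC⟩ := hK.exists_bound_of_continuousOn (continuousOn_id.sub hA)
    exact ⟨max C 0, le_max_right _ _, id, isShearComposition_id hn, fun z hz =>
      (hC z hz).trans (le_max_left _ _)⟩
  obtain ⟨a, ⟨-, ψ, hψ, h⟩, hae⟩ := exists_lt_of_csInf_lt hne he
  exact ⟨ψ, hψ, fun z hz => (h z hz).trans hae.le⟩

theorem shearDist_le_add (hn : 0 < n) (hK : IsCompact K) (hA : ContinuousOn A K) {c : ℝ}
    (hc : 0 ≤ c) (hAB : ∀ z ∈ K, ‖A z - B z‖ ≤ c) : shearDist B K ≤ shearDist A K + c := by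
  refine le_of_forall_pos_le_add fun ε hε => ?_
  obtain ⟨ψ, hψ, h⟩ := exists_of_shearDist_lt hn hK hA (lt_add_of_pos_right (shearDist A K) hε)
  refine shearDist_le (by linarith [shearDist_nonneg (A := A) (K := K)]) hψ fun z hz => ?_
  calc ‖ψ z - B z‖ = ‖(ψ z - A z) + (A z - B z)‖ := by congr 1; abel
    _ ≤ (shearDist A K + ε) + c := (norm_add_le _ _).trans (add_le_add (h z hz) (hAB z hz))
    _ = _ := by ring

theorem isShearApproximable_iff (hn : 0 < n) (hK : IsCompact K) (hA : ContinuousOn A K) :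
    IsShearApproximable A K ↔ shearDist A K ≤ 0 := by
  refine ⟨fun h => le_of_forall_pos_le_add fun ε hε => ?_, fun h ε hε =>
    exists_of_shearDist_lt hn hK hA (h.trans_lt hε)⟩
  obtain ⟨ψ, hψ, h⟩ := h ε hε
  rw [zero_add]
  exact shearDist_le hε.le hψ h

/-- Maps uniformly close to an injective holomorphic map with Runge image are all
approximable by compositions of shears as soon as one of them is. -/
theorem exists_nhds_isShearApproximable (hn : 2 ≤ n) {Ω : Set (EuclideanSpace ℂ (Fin n))}
    (hΩ : IsOpen Ω) (hK : IsCompact K) (hKΩ : K ⊆ Ω)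
    {Φ : EuclideanSpace ℂ (Fin n) → EuclideanSpace ℂ (Fin n)} (hΦ : DifferentiableOn ℂ Φ Ω)
    (hinj : InjOn Φ Ω) (hRunge : IsRunge (Φ '' Ω)) :
    ∃ η > 0, ∃ K', IsCompact K' ∧ K' ⊆ Ω ∧
      ∀ A B : EuclideanSpace ℂ (Fin n) → EuclideanSpace ℂ (Fin n),
        DifferentiableOn ℂ A Ω → DifferentiableOn ℂ B Ω →
        (∀ z ∈ K', ‖A z - Φ z‖ ≤ η) → (∀ z ∈ K', ‖B z - Φ z‖ ≤ η) →
        IsShearApproximable A K → IsShearApproximable B K := by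
  have hn0 : 0 < n := by omega
  obtain ⟨G, hopen, hGd, hG⟩ := isOpen_image_and_differentiableOn_inverse rfl hΩ hΦ hinj
  have hYc : IsCompact (Φ '' K) := hK.image_of_continuousOn (hΦ.continuousOn.mono hKΩ)
  obtain ⟨r, hr, hN⟩ := hYc.exists_cthickening_subset_open hopen (image_mono hKΩ)
  set N := cthickening r (Φ '' K) with hNdef
  have hNc : IsCompact N := hYc.cthickening
  have hGΩ : MapsTo G (Φ '' Ω) Ω := by
    rintro _ ⟨z, hz, rfl⟩
    rwa [hG z hz]
  have hΦG : ∀ y ∈ Φ '' Ω, Φ (G y) = y := by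
    rintro _ ⟨z, hz, rfl⟩
    rw [hG z hz]
  have hKK' : K ⊆ G '' N := fun z hz =>
    ⟨Φ z, self_subset_cthickening _ (mem_image_of_mem Φ hz), hG z (hKΩ hz)⟩
  refine ⟨r / 64, by positivity, G '' N, hNc.image_of_continuousOn (hGd.continuousOn.mono hN),
    (image_mono hN).trans hGΩ.image_subset, fun A B hA hB hAΦ hBΦ happ => ?_⟩
  set Ψ : ℝ → EuclideanSpace ℂ (Fin n) → EuclideanSpace ℂ (Fin n) := fun s z =>
    A z + (s : ℂ) • (B z - A z) with hΨ
  have hΨd : ∀ s, DifferentiableOn ℂ (Ψ s) Ω := fun s => hA.fun_add ((hB.fun_sub hA).fun_const_smul _)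
  have hΨc : ∀ s, ContinuousOn (Ψ s) K := fun s => (hΨd s).continuousOn.mono hKΩ
  have hV : ∀ z ∈ G '' N, ‖B z - A z‖ ≤ r / 32 := by
    intro z hz
    calc ‖B z - A z‖ = ‖(B z - Φ z) - (A z - Φ z)‖ := by congr 1; abel
      _ ≤ r / 64 + r / 64 := (norm_sub_le _ _).trans (add_le_add (hBΦ z hz) (hAΦ z hz))
      _ = r / 32 := by ring
  have hΨΦ : ∀ s ∈ Icc (0 : ℝ) 1, ∀ z ∈ G '' N, ‖Ψ s z - Φ z‖ ≤ r / 64 := by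
    intro s hs z hz
    have h1 : Ψ s z - Φ z = ((1 - s : ℝ) : ℂ) • (A z - Φ z) + (s : ℂ) • (B z - Φ z) := by
      simp only [hΨ]
      push_cast
      module
    have hs' : 0 ≤ 1 - s := by linarith [hs.2]
    rw [h1]
    refine (norm_add_le _ _).trans ?_
    rw [norm_smul, norm_smul, Complex.norm_real, Complex.norm_real, Real.norm_of_nonneg hs.1,
      Real.norm_of_nonneg hs']
    have := hAΦ z hz
    have := hBΦ z hz
    nlinarith [hs.1]
  have hΨs : ∀ s t : ℝ, ∀ z ∈ K, ‖Ψ s z - Ψ t z‖ ≤ r / 32 * |s - t| := by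
    intro s t z hz
    have h1 : Ψ s z - Ψ t z = ((s - t : ℝ) : ℂ) • (B z - A z) := by
      simp only [hΨ]
      push_cast
      module
    rw [h1, norm_smul, Complex.norm_real, Real.norm_eq_abs, mul_comm]
    exact mul_le_mul_of_nonneg_right (hV z (hKK' hz)) (abs_nonneg _)
  have hlip : ∀ s t, shearDist (Ψ t) K ≤ shearDist (Ψ s) K + r / 32 * |s - t| := fun s t =>
    shearDist_le_add hn0 hK (hΨc s) (by positivity) (hΨs s t)
  have hcont : Continuous fun s => shearDist (Ψ s) K := by
    refine (LipschitzWith.of_dist_le' (K := r / 32) fun s t => ?_).continuous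
    rw [Real.dist_eq, Real.dist_eq, abs_le]
    have h1 := hlip s t
    have h2 := hlip t s
    rw [abs_sub_comm t s] at h2
    constructor <;> linarith
  set L := 8 * (r / 32 + 1) / r with hL
  have hL0 : 0 < L := by positivity
  have hstep : ∀ s ∈ Icc (0 : ℝ) 1, ∀ ε > 0, ∃ δ > 0, ∀ h, 0 < h → h < δ →
      shearDist (Ψ (s + h)) K ≤ shearDist (Ψ s) K + h * ((L + 2) * shearDist (Ψ s) K + ε) := by
    intro s hs ε hε
    have hD0 := shearDist_nonneg (A := Ψ s) (K := K)
    set D := shearDist (Ψ s) K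
    rcases le_or_gt (r / 64) D with hD | hD
    · refine ⟨1, one_pos, fun h hh _ => (hlip s (s + h)).trans ?_⟩
      rw [sub_add_cancel_left, abs_neg, abs_of_pos hh]
      have : r / 32 ≤ (L + 2) * D + ε := by nlinarith
      nlinarith
    · obtain ⟨P, hP, hPg⟩ := hRunge.exists_polynomialMap_perturbation hN hNc (Y := Φ '' K)
        (M := r / 32) (U := fun y => Ψ s (G y) - Φ (G y)) (g := fun y => B (G y) - A (G y)) hr
        (by positivity) (fun y hy => closedBall_subset_cthickening hy r)
        (((hΨd s).comp hGd hGΩ).sub (hΦ.comp hGd hGΩ)) ((hB.comp hGd hGΩ).sub (hA.comp hGd hGΩ))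
        (fun y hy => hΨΦ s hs _ (mem_image_of_mem G hy)) (fun y hy => hV _ (mem_image_of_mem G hy))
        (show 0 < ε / 4 by positivity)
      obtain ⟨R, hR⟩ := hK.exists_bound_of_continuousOn (hΨc s)
      obtain ⟨δ, hδ, hδP⟩ := (hP.isShearField hn).2 (R + r / 64) (ε / 4) (by positivity)
      refine ⟨min δ (min (1 / L) ((r / 64 - D) / ε)), ?_, fun h hh hlt => ?_⟩
      · have : 0 < r / 64 - D := by linarith
        positivity
      simp only [lt_min_iff] at hlt
      obtain ⟨hlt1, hlt2, hlt3⟩ := hlt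
      rw [lt_div_iff₀ (by positivity)] at hlt2 hlt3
      obtain ⟨ψ, hψ, hψΨ⟩ := exists_of_shearDist_lt hn0 hK (hΨc s)
        (show shearDist (Ψ s) K < D + h * (ε / 4) by
          have : 0 < h * (ε / 4) := by positivity
          exact lt_add_of_pos_right _ this)
      obtain ⟨θ, hθ, hθP⟩ := hδP h hh hlt1
      have hfin : ∀ z ∈ K, ‖(θ ∘ ψ) z - Ψ (s + h) z‖ ≤ D + h * ((L + 2) * D + ε) := by
        intro z hz
        have e1 := hψΨ z hz
        have e1' : ‖ψ z - Ψ s z‖ ≤ r / 64 := e1.trans (by nlinarith)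
        have e2 : ‖ψ z‖ ≤ R + r / 64 := by
          calc ‖ψ z‖ = ‖Ψ s z + (ψ z - Ψ s z)‖ := by congr 1; abel
            _ ≤ R + r / 64 := (norm_add_le _ _).trans (add_le_add (hR z hz) e1')
        have e3 := hθP (ψ z) e2
        have hGz := hG z (hKΩ hz)
        have hUz : Φ z + (Ψ s (G (Φ z)) - Φ (G (Φ z))) = Ψ s z := by rw [hGz]; abel
        have e4 := hPg (Φ z) (mem_image_of_mem Φ hz) (ψ z) (by simp only [hUz]; exact e1')
        rw [hUz, hGz] at e4
        have e5 : ‖P (ψ z) - (B z - A z)‖ ≤ L * (D + h * (ε / 4)) + ε / 4 :=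
          e4.trans (by gcongr)
        calc ‖(θ ∘ ψ) z - Ψ (s + h) z‖
            = ‖(θ (ψ z) - ψ z - (h : ℂ) • P (ψ z)) + (ψ z - Ψ s z) +
                (h : ℂ) • (P (ψ z) - (B z - A z))‖ := by
              congr 1
              simp only [hΨ, Function.comp]
              push_cast
              module
          _ ≤ ε / 4 * h + (D + h * (ε / 4)) + h * (L * (D + h * (ε / 4)) + ε / 4) := by
              refine norm_add₃_le.trans (add_le_add (add_le_add e3 e1) ?_)
              rw [norm_smul, Complex.norm_real, Real.norm_of_nonneg hh.le]
              exact mul_le_mul_of_nonneg_left e5 hh.le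
          _ = D + h * (L * D + 3 * (ε / 4) + (h * L) * (ε / 4)) := by ring
          _ ≤ D + h * ((L + 2) * D + ε) := by
              have hle : h * L * (ε / 4) ≤ 1 * (ε / 4) := by gcongr
              exact add_le_add_right (mul_le_mul_of_nonneg_left (by linarith) hh.le) D
      exact shearDist_le (by positivity) (hθ.comp hψ) hfin
  have hΨ0 : Ψ 0 = A := by funext z; simp [hΨ]
  have hΨ1 : Ψ 1 = B := by funext z; simp [hΨ]
  have := eq_zero_of_liminf_slope_le (f := fun s => shearDist (Ψ s) K) hcont.continuousOn
    ((isShearApproximable_iff hn0 hK (hΨc 0)).1 (hΨ0 ▸ happ)) hstep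
  exact hΨ1 ▸ (isShearApproximable_iff hn0 hK (hΨc 1)).2 this

theorem isShearApproximable_of_isotopy (hn : 2 ≤ n) {Ω : Set (EuclideanSpace ℂ (Fin n))}
    (hΩ : IsOpen Ω) (Φ : ℝ → EuclideanSpace ℂ (Fin n) → EuclideanSpace ℂ (Fin n))
    (hcont : ContinuousOn (fun p : ℝ × EuclideanSpace ℂ (Fin n) => Φ p.1 p.2) (Icc (0 : ℝ) 1 ×ˢ Ω))
    (hinj : ∀ t ∈ Icc (0 : ℝ) 1, InjOn (Φ t) Ω)
    (hhol : ∀ t ∈ Icc (0 : ℝ) 1, DifferentiableOn ℂ (Φ t) Ω)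
    (hRunge : ∀ t ∈ Icc (0 : ℝ) 1, IsRunge (Φ t '' Ω))
    (hK : IsCompact K) (hKΩ : K ⊆ Ω) (h0 : IsShearApproximable (Φ 0) K) :
    IsShearApproximable (Φ 1) K := by
  have hloc : IsLocallyConstant fun t : Icc (0 : ℝ) 1 => IsShearApproximable (Φ t) K := by
    rw [IsLocallyConstant.iff_eventually_eq]
    rintro ⟨t, ht⟩
    obtain ⟨η, hη, K', hK', hK'Ω, hAB⟩ := exists_nhds_isShearApproximable hn hΩ hK hKΩ
      (hhol t ht) (hinj t ht) (hRunge t ht)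
    have huc := (isCompact_Icc.prod hK').uniformContinuousOn_of_continuous
      (hcont.mono (prod_mono Subset.rfl hK'Ω))
    obtain ⟨δ, hδ, hclose⟩ := Metric.uniformContinuousOn_iff.1 huc η hη
    filter_upwards [ball_mem_nhds _ hδ] with a ha
    have ha' : ∀ z ∈ K', ‖Φ a z - Φ t z‖ ≤ η := by
      intro z hz
      have := hclose (a, z) ⟨a.2, hz⟩ (t, z) ⟨ht, hz⟩ (by
        rw [Prod.dist_eq, dist_self, max_eq_left dist_nonneg]
        exact ha)
      rw [← dist_eq_norm]
      exact this.le
    have ht' : ∀ z ∈ K', ‖Φ t z - Φ t z‖ ≤ η := fun z _ => by simpa using hη.le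
    exact propext ⟨hAB _ _ (hhol a a.2) (hhol t ht) ha' ht', hAB _ _ (hhol t ht) (hhol a a.2) ht' ha'⟩
  have := hloc.apply_eq_of_preconnectedSpace ⟨0, by simp⟩ ⟨1, by simp⟩
  exact this.mp h0

end Isotopy

end

/-- Forstnerič–Rosay: an isotopy of injective holomorphic maps on a domain Ω ⊆ ℂⁿ (n ≥ 2)
with Runge images, starting at the identity, can be approximated uniformly on compacts by
finite compositions of shears. -/
theorem forstneric_rosay_shear_approximation (n : ℕ) (hn : 2 ≤ n)
    (Ω : Set (EuclideanSpace ℂ (Fin n))) (hΩopen : IsOpen Ω) (hΩconn : IsConnected Ω)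
    (Φ : ℝ → EuclideanSpace ℂ (Fin n) → EuclideanSpace ℂ (Fin n))
    (hcont : ContinuousOn (fun p : ℝ × EuclideanSpace ℂ (Fin n) => Φ p.1 p.2)
      (Set.Icc (0 : ℝ) 1 ×ˢ Ω))
    (hinj : ∀ t ∈ Set.Icc (0 : ℝ) 1, Set.InjOn (Φ t) Ω)
    (hhol : ∀ t ∈ Set.Icc (0 : ℝ) 1, DifferentiableOn ℂ (Φ t) Ω)
    (h0 : ∀ z ∈ Ω, Φ 0 z = z)
    (hRunge : ∀ t ∈ Set.Icc (0 : ℝ) 1, IsRunge (Φ t '' Ω)) :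
    ∀ K : Set (EuclideanSpace ℂ (Fin n)), K ⊆ Ω → IsCompact K → ∀ ε : ℝ, 0 < ε →
      ∃ ψ : EuclideanSpace ℂ (Fin n) → EuclideanSpace ℂ (Fin n),
        IsShearComposition ψ ∧ ∀ z ∈ K, ‖ψ z - Φ 1 z‖ < ε := by
  intro K hKΩ hK ε hε
  have hstart : IsShearApproximable (Φ 0) K := fun ε hε =>
    ⟨id, isShearComposition_id (by omega), fun z hz => by simpa [h0 z (hKΩ hz)] using hε.le⟩
  obtain ⟨ψ, hψ, h⟩ := isShearApproximable_of_isotopy hn hΩopen Φ hcont hinj hhol hRunge hK hKΩ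
    hstart (ε / 2) (half_pos hε)
  exact ⟨ψ, hψ, fun z hz => (h z hz).trans_lt (half_lt_self hε)⟩
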